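/- arXiv:2409.00901 — 2 statements merged into one kernel-verified Lean document; each statement's English description precedes it below -/
import Mathlib

section
/- (Approximation of the product function) For any integers k ≥ 4 and L ≥ 1, there exists f ∈ NN_{2,1}(3k·2^k + 3, L) such that f(x,y) ∈ [−1,1] for all (x,y) ∈ [−1,1]², and |f(x,y) − xy| ≤ 2^{−2kL−1} for all x, y ∈ [−1,1]. -/
open MeasureTheory ENNReal Finset

noncomputable section

/-- The ReLU activation function. -/
def relu (t : ℝ) : ℝ := max t 0

/-- `A` is an affine map `ℝ^n → ℝ^m`. -/
def IsAffineMap {n m : ℕ} (A : (Fin n → ℝ) → (Fin m → ℝ)) : Prop :=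
  ∃ (M : Matrix (Fin m) (Fin n) ℝ) (c : Fin m → ℝ),
    ∀ x i, A x i = (∑ j, M i j * x j) + c i

/-- Auxiliary definition of the ReLU network class, by recursion on the number
of hidden layers. -/
def NNaux (k W : ℕ) : ℕ → (d : ℕ) → Set ((Fin d → ℝ) → (Fin k → ℝ))
  | 0, _ => {g | IsAffineMap g}
  | (L + 1), d => {g | ∃ N : ℕ, 1 ≤ N ∧ N ≤ W ∧
      ∃ (A : (Fin d → ℝ) → (Fin N → ℝ)) (h : (Fin N → ℝ) → (Fin k → ℝ)),
        IsAffineMap A ∧ h ∈ NNaux k W L N ∧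
        g = fun x => h (fun i => relu (A x i))}

/-- The class `NN_{d,k}(W,L)` of functions `ℝ^d → ℝ^k` computed by fully connected
ReLU networks with width at most `W` and `L` hidden layers. -/
def NN (d k W L : ℕ) : Set ((Fin d → ℝ) → (Fin k → ℝ)) := NNaux k W L d

end

theorem IsAffineMap.comp {n m l : ℕ} {B : (Fin m → ℝ) → (Fin l → ℝ)}
    {A : (Fin n → ℝ) → (Fin m → ℝ)} (hB : IsAffineMap B) (hA : IsAffineMap A) :
    IsAffineMap (fun x => B (A x)) := by
  obtain ⟨M, c, hM⟩ := hB
  obtain ⟨M', c', hM'⟩ := hA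
  refine ⟨M * M', fun i => ∑ j, M i j * c' j + c i, fun x i => ?_⟩
  simp only [hM, hM', Matrix.mul_apply, mul_add, Finset.sum_add_distrib, Finset.mul_sum,
    Finset.sum_mul, mul_assoc]
  rw [Finset.sum_comm]
  ring

theorem NNaux_comp_affine {k W L n d : ℕ} {h : (Fin n → ℝ) → (Fin k → ℝ)}
    {A : (Fin d → ℝ) → (Fin n → ℝ)} (hh : h ∈ NNaux k W L n) (hA : IsAffineMap A) :
    (fun x => h (A x)) ∈ NNaux k W L d := by
  cases L with
  | zero => exact IsAffineMap.comp hh hA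
  | succ L =>
    obtain ⟨N, h1, hN, B, g, hB, hg, rfl⟩ := hh
    exact ⟨N, h1, hN, fun x => B (A x), g, hB.comp hA, hg, rfl⟩

/-- Precomposing a network with linear combinations of at most `W` ReLU neurons adds one
hidden layer. -/
theorem NNaux_comp_layer {ι : Type*} [Fintype ι] [Nonempty ι] {k W L n d : ℕ}
    (hW : Fintype.card ι ≤ W) {h : (Fin n → ℝ) → (Fin k → ℝ)} (hh : h ∈ NNaux k W L n)
    (w : ι → Fin d → ℝ) (b : ι → ℝ) {F : (Fin d → ℝ) → (Fin n → ℝ)}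
    (hF : ∀ l, (fun x => F x l) ∈ Submodule.span ℝ
      (Set.range fun (i : ι) (x : Fin d → ℝ) => relu (∑ j, w i j * x j + b i))) :
    (fun x => h (F x)) ∈ NNaux k W (L + 1) d := by
  simp only [Submodule.mem_span_range_iff_exists_fun] at hF
  choose c hc using hF
  let e := Fintype.equivFin ι
  refine ⟨Fintype.card ι, Fintype.card_pos, hW,
    fun x i => ∑ j, w (e.symm i) j * x j + b (e.symm i),
    fun z => h (fun l => ∑ i, c l (e.symm i) * z i + 0), ⟨_, _, fun _ _ => rfl⟩,
    NNaux_comp_affine hh ⟨fun l i => c l (e.symm i), fun _ => 0, fun _ _ => rfl⟩, ?_⟩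
  funext x
  congr 1
  funext l
  have := congrFun (hc l) x
  simp only [Finset.sum_apply, Pi.smul_apply, smul_eq_mul] at this
  rw [add_zero, ← this, ← e.symm.sum_comp]

/-- The span of the ReLU functions with kinks on the dyadic grid of mesh `2⁻ᵏ` in `[0, 1]`. -/
def gridSpan (k : ℕ) : Submodule ℝ (ℝ → ℝ) :=
  Submodule.span ℝ (Set.range fun (j : Fin (2 ^ k + 1)) (t : ℝ) => relu (t - (j : ℕ) / 2 ^ k))

theorem relu_sub_mem_gridSpan {k j : ℕ} (hj : j ≤ 2 ^ k) {a : ℝ} (ha : a = j / 2 ^ k) :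
    (fun t => relu (t - a)) ∈ gridSpan k :=
  Submodule.subset_span ⟨⟨j, Nat.lt_succ_of_le hj⟩, by simp [ha]⟩

theorem relu_mem_gridSpan (k : ℕ) : relu ∈ gridSpan k := by
  simpa using relu_sub_mem_gridSpan (k := k) (j := 0) (a := 0) (Nat.zero_le _) (by simp)

/-- The tent function on `[0, 1]` of height one, extended by zero. -/
noncomputable def tent (t : ℝ) : ℝ := 2 * relu t - 4 * relu (t - 1 / 2) + 2 * relu (t - 1)

theorem tent_eq_left {t : ℝ} (h0 : 0 ≤ t) (h1 : t ≤ 1 / 2) : tent t = 2 * t := by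
  rw [tent, relu, relu, relu, max_eq_left h0, max_eq_right (by linarith),
    max_eq_right (by linarith)]
  ring

theorem tent_eq_right {t : ℝ} (h0 : 1 / 2 ≤ t) (h1 : t ≤ 1) : tent t = 2 - 2 * t := by
  rw [tent, relu, relu, relu, max_eq_left (by linarith), max_eq_left (by linarith),
    max_eq_right (by linarith)]
  ring

theorem tent_eq_zero_of_nonpos {t : ℝ} (h : t ≤ 0) : tent t = 0 := by
  rw [tent, relu, relu, relu, max_eq_right h, max_eq_right (by linarith),
    max_eq_right (by linarith)]
  ring

theorem tent_eq_zero_of_one_le {t : ℝ} (h : 1 ≤ t) : tent t = 0 := by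
  rw [tent, relu, relu, relu, max_eq_left (by linarith), max_eq_left (by linarith),
    max_eq_left (by linarith)]
  ring

theorem relu_tent_sub {a : ℝ} (h0 : 0 ≤ a) (h1 : a ≤ 1) (t : ℝ) :
    relu (tent t - a) =
      2 * relu (t - a / 2) - 4 * relu (t - 1 / 2) + 2 * relu (t - (1 - a / 2)) := by
  rcases le_total t 0 with ht | ht
  · rw [tent_eq_zero_of_nonpos ht]
    grind [relu]
  rcases le_total t (1 / 2) with ht' | ht'
  · rw [tent_eq_left ht ht']
    grind [relu]
  rcases le_total t 1 with ht1 | ht1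
  · rw [tent_eq_right ht' ht1]
    grind [relu]
  · rw [tent_eq_zero_of_one_le ht1]
    grind [relu]

theorem comp_tent_mem_gridSpan {k : ℕ} {g : ℝ → ℝ} (hg : g ∈ gridSpan k) :
    (fun t => g (tent t)) ∈ gridSpan (k + 1) := by
  induction hg using Submodule.span_induction with
  | mem g hg =>
    obtain ⟨j, rfl⟩ := hg
    have hj : (j : ℕ) ≤ 2 ^ k := Nat.le_of_lt_succ j.isLt
    have hk : (0 : ℝ) < 2 ^ k := by positivity
    have ha1 : ((j : ℕ) : ℝ) / 2 ^ k ≤ 1 := by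
      rw [div_le_one hk]
      exact_mod_cast hj
    have key := relu_tent_sub (a := ((j : ℕ) : ℝ) / 2 ^ k) (by positivity) ha1
    simp only [key]
    refine add_mem (sub_mem (Submodule.smul_mem _ 2 (relu_sub_mem_gridSpan (j := j) ?_ ?_))
      (Submodule.smul_mem _ 4 (relu_sub_mem_gridSpan (j := 2 ^ k) ?_ ?_)))
      (Submodule.smul_mem _ 2 (relu_sub_mem_gridSpan (j := 2 ^ (k + 1) - j) ?_ ?_))
    · rw [pow_succ]; omega
    · rw [pow_succ]; field_simp
    · rw [pow_succ]; omega
    · rw [pow_succ]; push_cast; field_simp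
    · omega
    · rw [Nat.cast_sub (by rw [pow_succ]; omega)]
      push_cast
      rw [pow_succ]
      field_simp
  | zero => exact zero_mem _
  | add f g _ _ hf hg => exact add_mem hf hg
  | smul c f _ hf => exact Submodule.smul_mem _ c hf

/-- The square function is piecewise linear on the dyadic grid up to a rescaled square of a
sawtooth function. -/
theorem exists_sq_decomposition (k : ℕ) : ∃ T ∈ gridSpan k, ∃ P ∈ gridSpan k,
    ∀ t ∈ Set.Icc (0 : ℝ) 1, T t ∈ Set.Icc (0 : ℝ) 1 ∧
      P t + (1 / 4) ^ k * T t ^ 2 = t ^ 2 ∧ P t + (1 / 4) ^ k * T t ≤ t := by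
  induction k with
  | zero =>
    refine ⟨relu, relu_mem_gridSpan 0, 0, zero_mem _, fun t ht => ?_⟩
    have : relu t = t := max_eq_left ht.1
    simp [this, ht.1, ht.2]
  | succ k ih =>
    obtain ⟨T, hT, P, hP, h⟩ := ih
    have htent : tent ∈ gridSpan (k + 1) := by
      convert comp_tent_mem_gridSpan (relu_mem_gridSpan k) using 2 with t
      simpa [tent] using (relu_tent_sub le_rfl zero_le_one t).symm
    refine ⟨fun t => T (tent t), comp_tent_mem_gridSpan hT,
      relu - (1 / 2 : ℝ) • tent + (1 / 4 : ℝ) • fun t => P (tent t),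
      add_mem (sub_mem (relu_mem_gridSpan _) (Submodule.smul_mem _ _ htent))
        (Submodule.smul_mem _ _ (comp_tent_mem_gridSpan hP)), fun t ht => ?_⟩
    have hr : relu t = t := max_eq_left ht.1
    have ht' : tent t ∈ Set.Icc (0 : ℝ) 1 ∧ t - tent t / 2 + tent t ^ 2 / 4 = t ^ 2 := by
      rcases le_total t (1 / 2) with h2 | h2
      · rw [tent_eq_left ht.1 h2]
        exact ⟨⟨by linarith [ht.1], by linarith⟩, by ring⟩
      · rw [tent_eq_right h2 ht.2]
        exact ⟨⟨by linarith [ht.2], by linarith⟩, by ring⟩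
    obtain ⟨h1, h2, h3⟩ := h _ ht'.1
    refine ⟨h1, ?_, ?_⟩ <;>
      simp only [Pi.add_apply, Pi.sub_apply, Pi.smul_apply, smul_eq_mul, hr, pow_succ (1 / 4 : ℝ)]
    · linarith [ht'.2]
    · linarith [ht'.1.1]

/-- The linear part of the neuron `(l, s, j)`, which computes `relu (± x l - j / 2 ^ k)`. -/
noncomputable def neuronWeight (k : ℕ) (i : Fin 3 × Fin 2 × Fin (2 ^ k + 1)) : Fin 3 → ℝ :=
  Pi.single i.1 ((-1) ^ (i.2.1 : ℕ))

/-- The bias of the neuron `(l, s, j)`. -/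
noncomputable def neuronBias (k : ℕ) (i : Fin 3 × Fin 2 × Fin (2 ^ k + 1)) : ℝ :=
  -((i.2.2 : ℕ) / 2 ^ k)

/-- The functions computed by one hidden layer. -/
def layerSpan (k : ℕ) : Submodule ℝ ((Fin 3 → ℝ) → ℝ) :=
  Submodule.span ℝ (Set.range fun (i : Fin 3 × Fin 2 × Fin (2 ^ k + 1)) (x : Fin 3 → ℝ) =>
    relu (∑ j, neuronWeight k i j * x j + neuronBias k i))

theorem relu_neuron_mem_layerSpan (k : ℕ) (l : Fin 3) (s : Fin 2) (j : Fin (2 ^ k + 1)) :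
    (fun x : Fin 3 → ℝ => relu ((-1) ^ (s : ℕ) * x l - (j : ℕ) / 2 ^ k)) ∈ layerSpan k := by
  refine Submodule.subset_span ⟨(l, s, j), ?_⟩
  funext x
  simp [neuronWeight, neuronBias, Pi.single_apply, sub_eq_add_neg]

theorem comp_abs_mem_layerSpan {k : ℕ} {g : ℝ → ℝ} (hg : g ∈ gridSpan k) (l : Fin 3) :
    (fun x : Fin 3 → ℝ => g |x l|) ∈ layerSpan k := by
  induction hg using Submodule.span_induction with
  | mem g hg =>
    obtain ⟨j, rfl⟩ := hg
    convert add_mem (relu_neuron_mem_layerSpan k l 0 j) (relu_neuron_mem_layerSpan k l 1 j)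
      using 1
    funext x
    have hc : (0 : ℝ) ≤ (j : ℕ) / 2 ^ k := by positivity
    simp only [Pi.add_apply, Fin.val_zero, Fin.val_one, pow_zero, pow_one, one_mul, neg_mul]
    generalize ((j : ℕ) : ℝ) / 2 ^ k = c at hc
    grind [relu]
  | zero => exact zero_mem _
  | add f g _ _ hf hg => exact add_mem hf hg
  | smul c f _ hf => exact Submodule.smul_mem _ c hf

theorem coord_mem_layerSpan (k : ℕ) (l : Fin 3) :
    (fun x : Fin 3 → ℝ => x l) ∈ layerSpan k := by
  convert sub_mem (relu_neuron_mem_layerSpan k l 0 0) (relu_neuron_mem_layerSpan k l 1 0)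
    using 1
  funext x
  simp only [Pi.sub_apply, Fin.val_zero, Fin.val_one, pow_zero, pow_one, one_mul, neg_mul,
    Nat.cast_zero, zero_div, sub_zero]
  grind [relu]

/-- `g (p, q, a)` approximates `a + c * (p ^ 2 - q ^ 2)` for `p, q ∈ s`, with error at most
`c * ε`, between the stated bounds. -/
def ApproxSqSub (s : Set ℝ) (c ε : ℝ) (g : (Fin 3 → ℝ) → (Fin 1 → ℝ)) : Prop :=
  ∀ p ∈ s, ∀ q ∈ s, ∀ a : ℝ,
    |g ![p, q, a] 0 - (a + c * (p ^ 2 - q ^ 2))| ≤ c * ε ∧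
    a + c * (p ^ 2 - |q|) ≤ g ![p, q, a] 0 ∧ g ![p, q, a] 0 ≤ a + c * (|p| - q ^ 2)

theorem exists_approxSqSub_succ {k W L : ℕ} (hW : 6 * (2 ^ k + 1) ≤ W) {c ε : ℝ} (hc : 0 ≤ c)
    (h : ∃ g ∈ NNaux 1 W L 3, ApproxSqSub (Set.Icc 0 1) (c * (1 / 4) ^ k) ε g) :
    ∃ g ∈ NNaux 1 W (L + 1) 3, ApproxSqSub (Set.Icc (-1) 1) c ((1 / 4) ^ k * ε) g := by
  obtain ⟨g, hg, hga⟩ := h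
  obtain ⟨T, hT, P, hP, hTP⟩ := exists_sq_decomposition k
  let F : (Fin 3 → ℝ) → (Fin 3 → ℝ) := fun x =>
    ![T |x 0|, T |x 1|, x 2 + c * (P |x 0| - P |x 1|)]
  refine ⟨fun x => g (F x), NNaux_comp_layer (ι := Fin 3 × Fin 2 × Fin (2 ^ k + 1)) ?_ hg
    (neuronWeight k) (neuronBias k) (fun l => ?_), fun p hp q hq a => ?_⟩
  · simp only [Fintype.card_prod, Fintype.card_fin]
    omega
  · change _ ∈ layerSpan k
    fin_cases l
    · exact comp_abs_mem_layerSpan hT 0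
    · exact comp_abs_mem_layerSpan hT 1
    · exact add_mem (coord_mem_layerSpan k 2) (Submodule.smul_mem _ c
        (sub_mem (comp_abs_mem_layerSpan hP 0) (comp_abs_mem_layerSpan hP 1)))
  · obtain ⟨hp1, hp2, hp3⟩ := hTP |p| ⟨abs_nonneg p, abs_le.2 hp⟩
    obtain ⟨hq1, hq2, hq3⟩ := hTP |q| ⟨abs_nonneg q, abs_le.2 hq⟩
    obtain ⟨e1, e2, e3⟩ := hga _ hp1 _ hq1 (a + c * (P |p| - P |q|))
    rw [sq_abs] at hp2 hq2
    rw [abs_of_nonneg hq1.1] at e2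
    rw [abs_of_nonneg hp1.1] at e3
    have hp4 := mul_le_mul_of_nonneg_left hp3 hc
    have hq4 := mul_le_mul_of_nonneg_left hq3 hc
    change |g ![T |p|, T |q|, a + c * (P |p| - P |q|)] 0 - _| ≤ _ ∧
      _ ≤ g ![T |p|, T |q|, a + c * (P |p| - P |q|)] 0 ∧
      g ![T |p|, T |q|, a + c * (P |p| - P |q|)] 0 ≤ _
    refine ⟨?_, ?_, ?_⟩
    · rw [← mul_assoc]
      convert e1 using 3
      rw [← hp2, ← hq2]
      ring
    · refine le_trans ?_ e2
      rw [← hp2]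
      linarith
    · refine e3.trans ?_
      rw [← hq2]
      linarith

theorem exists_approxSqSub_unit {k W : ℕ} (hW : 6 * (2 ^ k + 1) ≤ W) (L : ℕ) :
    ∀ c : ℝ, 0 ≤ c → ∃ g ∈ NNaux 1 W L 3,
      ApproxSqSub (Set.Icc 0 1) c ((1 / 4) ^ (k * L) * (1 / 4)) g := by
  induction L with
  | zero =>
    intro c hc
    refine ⟨fun x _ => ∑ j, ![c, -c, 1] j * x j + 0,
      ⟨fun _ => ![c, -c, 1], fun _ => 0, fun _ _ => rfl⟩, fun p hp q hq a => ?_⟩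
    simp only [Fin.sum_univ_three, Matrix.cons_val, abs_of_nonneg hp.1, abs_of_nonneg hq.1,
      mul_zero, pow_zero, one_mul]
    have hp' : 0 ≤ p - p ^ 2 ∧ p - p ^ 2 ≤ 1 / 4 :=
      ⟨by nlinarith [hp.1, hp.2], by nlinarith [sq_nonneg (p - 1 / 2)]⟩
    have hq' : 0 ≤ q - q ^ 2 ∧ q - q ^ 2 ≤ 1 / 4 :=
      ⟨by nlinarith [hq.1, hq.2], by nlinarith [sq_nonneg (q - 1 / 2)]⟩
    refine ⟨?_, ?_, ?_⟩
    · rw [show c * p + -c * q + a + 0 - (a + c * (p ^ 2 - q ^ 2))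
        = c * ((p - p ^ 2) - (q - q ^ 2)) by ring, abs_mul, abs_of_nonneg hc]
      exact mul_le_mul_of_nonneg_left (abs_le.2 ⟨by linarith, by linarith⟩) hc
    · linarith [mul_nonneg hc hp'.1]
    · linarith [mul_nonneg hc hq'.1]
  | succ L ih =>
    intro c hc
    obtain ⟨g, hg, h⟩ := exists_approxSqSub_succ hW hc (ih _ (by positivity))
    refine ⟨g, hg, fun p hp q hq a => ?_⟩
    rw [show k * (L + 1) = k + k * L by ring, pow_add, mul_assoc]
    exact h p ⟨by linarith [hp.1], hp.2⟩ q ⟨by linarith [hq.1], hq.2⟩ a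

theorem product_approx (k L : ℕ) (hk : 4 ≤ k) (hL : 1 ≤ L) :
    ∃ f ∈ NN 2 1 (3 * k * 2 ^ k + 3) L,
      ∀ x y : ℝ, x ∈ Set.Icc (-1 : ℝ) 1 → y ∈ Set.Icc (-1 : ℝ) 1 →
        f ![x, y] 0 ∈ Set.Icc (-1 : ℝ) 1 ∧
        |f ![x, y] 0 - x * y| ≤ (2 : ℝ) ^ (-(2 * (k : ℤ) * (L : ℤ)) - 1) := by
  have hW : 6 * (2 ^ k + 1) ≤ 3 * k * 2 ^ k + 3 := by
    have h1 : 12 * 2 ^ k ≤ 3 * k * 2 ^ k := Nat.mul_le_mul_right _ (by omega)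
    have h2 : 1 ≤ 2 ^ k := Nat.one_le_two_pow
    omega
  obtain ⟨n, rfl⟩ := Nat.exists_eq_add_of_le' hL
  obtain ⟨g, hg, hga⟩ := exists_approxSqSub_succ hW zero_le_one
    (exists_approxSqSub_unit hW n _ (by positivity))
  refine ⟨_, NNaux_comp_affine (d := 2)
    (A := fun x i => ∑ j, !![1 / 2, 1 / 2; 1 / 2, -(1 / 2); 0, 0] i j * x j + 0) hg
    ⟨_, fun _ => 0, fun _ _ => rfl⟩, fun x y hx hy => ?_⟩
  have hA : (fun i => ∑ j, !![1 / 2, 1 / 2; 1 / 2, -(1 / 2); 0, 0] i j * ![x, y] j + 0)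
      = ![(x + y) / 2, (x - y) / 2, (0 : ℝ)] := by
    funext i
    fin_cases i <;> simp [Fin.sum_univ_two] <;> ring
  have hp : (x + y) / 2 ∈ Set.Icc (-1 : ℝ) 1 := ⟨by linarith [hx.1, hy.1], by linarith [hx.2, hy.2]⟩
  have hq : (x - y) / 2 ∈ Set.Icc (-1 : ℝ) 1 := ⟨by linarith [hx.1, hy.2], by linarith [hx.2, hy.1]⟩
  obtain ⟨h1, h2, h3⟩ := hga _ hp _ hq 0
  simp only [hA]
  refine ⟨⟨?_, ?_⟩, ?_⟩
  · linarith [abs_le.2 hq, sq_nonneg ((x + y) / 2)]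
  · linarith [abs_le.2 hp, sq_nonneg ((x - y) / 2)]
  · have hxy : 0 + 1 * (((x + y) / 2) ^ 2 - ((x - y) / 2) ^ 2) = x * y := by ring
    rw [hxy, one_mul] at h1
    refine h1.trans ?_
    have hpow : (2 : ℝ) ^ (-(2 * (k : ℤ) * ((n + 1 : ℕ) : ℤ)) - 1)
        = (1 / 4) ^ k * (1 / 4) ^ (k * n) * (1 / 2) := by
      rw [← pow_add, zpow_sub₀ two_ne_zero, zpow_neg, mul_assoc, zpow_mul,
        show k + k * n = k * (n + 1) by ring, one_div_pow, div_eq_mul_inv, zpow_one, one_div,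
        one_div, show (2 : ℝ) ^ (2 : ℤ) = 4 by norm_num]
      norm_cast
    rw [hpow, ← mul_assoc]
    gcongr
    norm_num
end

section
/- (Approximation of piecewise polynomials, sparse regime) Let d ≥ 1, b ≥ 2 an integer, ℓ, k ∈ ℕ, 0 < ε < b^{−ℓ}, 1 ≤ q < ∞, q ≤ p ≤ ∞, and δ > 0 with δq ≤ dℓ. There exists a constant C > 0 depending only on p, q, d, k, b such that the following holds. Let f = Σ_{|γ|≤k, i∈I_ℓ} a_{i,γ} ρ_{ℓ,i}^γ with real coefficients a_{i,γ}. For any S, T, W₀, L₀ ∈ ℕ with S, T, W₀, L₀ ≥ 1, there exist W, L ∈ ℕ with W ≤ C·max{ b^{δq/2}/(S√T), b^{(dℓ−δq)/T}, b^{ℓ/L₀}, W₀·2^{W₀} } and L ≤ C·(ST + L₀), and g ∈ NN_{d,1}(W, L), such that ‖f − g‖_{L^p(Ω_{ℓ,ε})} ≤ C·( b^{δq/p − dℓ/p − δ} + 4^{−W₀L₀} )·( Σ_{|γ|≤k, i∈I_ℓ} |a_{i,γ}|^q )^{1/q}, where for p = ∞ one uses the conventions q/p = 0 and dℓ/p =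 0. -/
open MeasureTheory ENNReal Finset

noncomputable section

/-- The trimmed subcube `Ω_{i,ε}^ℓ` of the partition of `[0,1)^d` into `b^{dℓ}`
subcubes, where a strip of width `ε` is removed on the right of each coordinate
(except for the last subcube in each coordinate). -/
def trimmedCell (d b ℓ : ℕ) (ε : ℝ) (i : Fin d → ℕ) : Set (Fin d → ℝ) :=
  {x | ∀ j, if i j < b ^ ℓ - 1
      then (i j : ℝ) / (b : ℝ) ^ ℓ ≤ x j ∧ x j < ((i j : ℝ) + 1) / (b : ℝ) ^ ℓ - ε
      else 1 - ((b : ℝ) ^ ℓ)⁻¹ ≤ x j ∧ x j < 1}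

/-- The good region `Ω_{ℓ,ε}`, the union of all trimmed subcubes. -/
def goodRegion (d b ℓ : ℕ) (ε : ℝ) : Set (Fin d → ℝ) :=
  ⋃ i ∈ {i : Fin d → ℕ | ∀ j, i j < b ^ ℓ}, trimmedCell d b ℓ ε i

/-- The subcube `Ω_i^ℓ` of the partition of `[0,1)^d` into `b^{dℓ}` subcubes. -/
def baseCell (d b ℓ : ℕ) (i : Fin d → ℕ) : Set (Fin d → ℝ) :=
  {x | ∀ j, (i j : ℝ) / (b : ℝ) ^ ℓ ≤ x j ∧ x j < ((i j : ℝ) + 1) / (b : ℝ) ^ ℓ}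

open Classical in
/-- The basis function `ρ_{ℓ,i}^γ` of the space of piecewise polynomials of degree
at most `k` subordinate to the partition of `[0,1)^d` into `b^{dℓ}` subcubes. -/
def rho (d b ℓ : ℕ) (i γ : Fin d → ℕ) (x : Fin d → ℝ) : ℝ :=
  if x ∈ baseCell d b ℓ i then ∏ j, ((b : ℝ) ^ ℓ * x j - (i j : ℝ)) ^ (γ j) else 0

/-- The (finite) set of multi-indices `γ` with `|γ| ≤ k`. -/
def Γset (d k : ℕ) : Finset (Fin d → Fin (k + 1)) :=
  Finset.univ.filter fun γ => ∑ j, (γ j : ℕ) ≤ k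

/-- The piecewise polynomial with coefficients `a` in the basis `ρ_{ℓ,i}^γ`. -/
def ppoly (d b ℓ k : ℕ) (a : (Fin d → Fin (b ^ ℓ)) → (Fin d → Fin (k + 1)) → ℝ)
    (x : Fin d → ℝ) : ℝ :=
  ∑ i : Fin d → Fin (b ^ ℓ), ∑ γ ∈ Γset d k,
    a i γ * rho d b ℓ (fun j => (i j : ℕ)) (fun j => (γ j : ℕ)) x

section Steps

variable {X : Type*}

/-- The space of affine combinations of the functions in `s`. -/
def aff (s : Set (X → ℝ)) : Submodule ℝ (X → ℝ) := Submodule.span ℝ (insert 1 s)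

/-- `Steps w n s t` says that the functions in `t` can be computed from those in `s` by a ReLU
network with `n` hidden layers of width `w`. -/
def Steps (w : ℕ) : ℕ → Set (X → ℝ) → Set (X → ℝ) → Prop
  | 0, s, t => t ⊆ aff s
  | n + 1, s, t => ∃ h : Fin w → X → ℝ, (∀ i, h i ∈ aff s) ∧
      Steps w n (Set.range fun i x => relu (h i x)) t

theorem subset_aff (s : Set (X → ℝ)) : s ⊆ aff s :=
  Set.Subset.trans (Set.subset_insert _ _) Submodule.subset_span

theorem mem_aff {s : Set (X → ℝ)} {f : X → ℝ} (h : f ∈ s) : f ∈ aff s := subset_aff s h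

theorem const_mem_aff (s : Set (X → ℝ)) (c : ℝ) : (fun _ => c) ∈ aff s := by
  have h : (1 : X → ℝ) ∈ aff s := Submodule.subset_span (Set.mem_insert _ _)
  convert (aff s).smul_mem c h using 1
  ext x
  simp

theorem aff_le {s s' : Set (X → ℝ)} (h : s ⊆ aff s') : aff s ≤ aff s' :=
  Submodule.span_le.2 (Set.insert_subset (const_mem_aff s' 1) h)

theorem aff_mono {s s' : Set (X → ℝ)} (h : s ⊆ s') : aff s ≤ aff s' :=
  aff_le (Set.Subset.trans h (subset_aff s'))

theorem add_mem_aff {s : Set (X → ℝ)} {f g : X → ℝ} (hf : f ∈ aff s) (hg : g ∈ aff s) :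
    (fun x => f x + g x) ∈ aff s := (aff s).add_mem hf hg

theorem sub_mem_aff {s : Set (X → ℝ)} {f g : X → ℝ} (hf : f ∈ aff s) (hg : g ∈ aff s) :
    (fun x => f x - g x) ∈ aff s := (aff s).sub_mem hf hg

theorem neg_mem_aff {s : Set (X → ℝ)} {f : X → ℝ} (hf : f ∈ aff s) :
    (fun x => -f x) ∈ aff s := (aff s).neg_mem hf

theorem mul_mem_aff {s : Set (X → ℝ)} {f : X → ℝ} (c : ℝ) (hf : f ∈ aff s) :
    (fun x => c * f x) ∈ aff s := (aff s).smul_mem c hf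

theorem sum_mem_aff {ι : Type*} {s : Set (X → ℝ)} (I : Finset ι) {f : ι → X → ℝ}
    (hf : ∀ i ∈ I, f i ∈ aff s) : (fun x => ∑ i ∈ I, f i x) ∈ aff s := by
  convert (aff s).sum_mem hf using 1
  ext x
  simp

theorem mem_aff_range {m : ℕ} {u : Fin m → X → ℝ} {f : X → ℝ} (hf : f ∈ aff (Set.range u)) :
    ∃ (a : Fin m → ℝ) (c : ℝ), ∀ x, f x = (∑ j, a j * u j x) + c := by
  obtain ⟨c, z, hz, rfl⟩ := Submodule.mem_span_insert.1 hf
  obtain ⟨a, rfl⟩ := (Submodule.mem_span_range_iff_exists_fun ℝ).1 hz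
  exact ⟨a, c, fun x => by simp [add_comm]⟩

theorem relu_sub_relu_neg (t : ℝ) : relu t - relu (-t) = t := by
  unfold relu
  rcases le_total t 0 with h | h
  · rw [max_eq_right h, max_eq_left (by linarith)]; ring
  · rw [max_eq_left h, max_eq_right (by linarith)]; ring

theorem relu_of_nonneg {t : ℝ} (h : 0 ≤ t) : relu t = t := max_eq_left h

theorem relu_of_nonpos {t : ℝ} (h : t ≤ 0) : relu t = 0 := max_eq_right h

theorem relu_add_relu_neg (t : ℝ) : relu t + relu (-t) = |t| := by
  rcases le_total t 0 with h | h
  · rw [relu_of_nonpos h, relu_of_nonneg (by linarith), abs_of_nonpos h]; ring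
  · rw [relu_of_nonneg h, relu_of_nonpos (by linarith), abs_of_nonneg h]; ring

namespace Steps

theorem mono_left {w n : ℕ} {s s' t : Set (X → ℝ)} (h : Steps w n s t) (hs : s ⊆ aff s') :
    Steps w n s' t := by
  cases n with
  | zero => exact Set.Subset.trans h (aff_le hs)
  | succ n =>
    obtain ⟨u, hu, h⟩ := h
    exact ⟨u, fun i => aff_le hs (hu i), h⟩

theorem trans {w n m : ℕ} {s t u : Set (X → ℝ)} (h : Steps w n s t) (h' : Steps w m t u) :
    Steps w (n + m) s u := by
  induction n generalizing s with
  | zero => rw [zero_add]; exact h'.mono_left h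
  | succ n ih =>
    obtain ⟨v, hv, h⟩ := h
    rw [Nat.succ_add]
    exact ⟨v, hv, ih h⟩

theorem of_subset {w : ℕ} {s t : Set (X → ℝ)} (h : t ⊆ aff s) : Steps w 0 s t := h

theorem mono_right {w n : ℕ} {s t t' : Set (X → ℝ)} (h : Steps w n s t) (ht : t' ⊆ aff t) :
    Steps w n s t' := h.trans (of_subset ht)

theorem mono_width {w w' n : ℕ} {s t : Set (X → ℝ)} (h : Steps w n s t) (hw : w ≤ w') :
    Steps w' n s t := by
  induction n generalizing s with
  | zero => exact h
  | succ n ih =>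
    obtain ⟨v, hv, h⟩ := h
    refine ⟨fun i => if hi : i.1 < w then v ⟨i, hi⟩ else 0, fun i => ?_,
      mono_left (ih h) (Set.Subset.trans ?_ (subset_aff _))⟩
    · dsimp only
      split_ifs
      exacts [hv _, (aff s).zero_mem]
    · rintro _ ⟨i, rfl⟩
      exact ⟨⟨i, i.2.trans_le hw⟩, by simp⟩

theorem layer {ι : Type*} [Fintype ι] {w : ℕ} {s : Set (X → ℝ)} (h : ι → X → ℝ)
    (hs : ∀ i, h i ∈ aff s) (hw : Fintype.card ι ≤ w) :
    Steps w 1 s (Set.range fun i x => relu (h i x)) := by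
  refine mono_width (w := Fintype.card ι) ?_ hw
  refine ⟨fun j => h ((Fintype.equivFin ι).symm j), fun j => hs _, ?_⟩
  refine of_subset (Set.Subset.trans ?_ (subset_aff _))
  rintro _ ⟨i, rfl⟩
  exact ⟨Fintype.equivFin ι i, by simp⟩

theorem union {w w' n : ℕ} {s s' t t' : Set (X → ℝ)} (h : Steps w n s t)
    (h' : Steps w' n s' t') : Steps (w + w') n (s ∪ s') (t ∪ t') := by
  induction n generalizing s s' with
  | zero =>
    exact Set.union_subset (Set.Subset.trans h (aff_mono Set.subset_union_left))
      (Set.Subset.trans h' (aff_mono Set.subset_union_right))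
  | succ n ih =>
    obtain ⟨v, hv, h⟩ := h
    obtain ⟨v', hv', h'⟩ := h'
    refine ⟨Fin.append v v', fun i => ?_, (ih h h').mono_left ?_⟩
    · refine Fin.addCases (fun i => ?_) (fun i => ?_) i
      · rw [Fin.append_left]; exact aff_mono Set.subset_union_left (hv i)
      · rw [Fin.append_right]; exact aff_mono Set.subset_union_right (hv' i)
    · refine Set.Subset.trans (Set.union_subset ?_ ?_) (subset_aff _)
      · rintro _ ⟨i, rfl⟩; exact ⟨Fin.castAdd _ i, by simp⟩
      · rintro _ ⟨i, rfl⟩; exact ⟨Fin.natAdd _ i, by simp⟩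

theorem par {w w' n : ℕ} {s t t' : Set (X → ℝ)} (h : Steps w n s t)
    (h' : Steps w' n s t') : Steps (w + w') n s (t ∪ t') := by
  simpa using h.union h'

theorem par_finset {ι : Type*} {w n : ℕ} {s : Set (X → ℝ)} {t : ι → Set (X → ℝ)} (I : Finset ι)
    (h : ∀ i ∈ I, Steps w n s (t i)) : Steps (I.card * w) n s (⋃ i ∈ I, t i) := by
  classical
  induction I using Finset.induction_on with
  | empty =>
    simp only [Finset.notMem_empty, Set.iUnion_of_empty, Set.iUnion_empty]
    clear h
    induction n generalizing s with
    | zero => exact Set.empty_subset _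
    | succ n ih => exact ⟨fun _ => 0, fun _ => (aff s).zero_mem, ih⟩
  | insert i I hi ih =>
    rw [Finset.set_biUnion_insert, Finset.card_insert_of_notMem hi, Nat.succ_mul, add_comm]
    exact (h i (by simp)).par (ih fun j hj => h j (by simp [hj]))

theorem id_range {ι : Type*} [Fintype ι] (n : ℕ) (c : ι → X → ℝ) :
    Steps (2 * Fintype.card ι) n (Set.range c) (Set.range c) := by
  induction n with
  | zero => exact subset_aff _
  | succ n ih =>
    rw [add_comm]
    refine trans (mono_right (layer (ι := ι ⊕ ι)
      (Sum.elim c fun i x => -c i x) ?_ (by simp [two_mul])) ?_) ih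
    · rintro (i | i)
      · exact mem_aff ⟨i, rfl⟩
      · exact neg_mem_aff (mem_aff ⟨i, rfl⟩)
    · rintro _ ⟨i, rfl⟩
      have h := sub_mem_aff (mem_aff (s := Set.range fun (j : ι ⊕ ι) x =>
          relu (Sum.elim c (fun i x => -c i x) j x)) ⟨Sum.inl i, rfl⟩)
        (mem_aff ⟨Sum.inr i, rfl⟩)
      simpa [relu_sub_relu_neg] using h

theorem carry_range {ι : Type*} [Fintype ι] {w n : ℕ} {s t : Set (X → ℝ)} (h : Steps w n s t)
    (c : ι → X → ℝ) (hc : ∀ i, c i ∈ aff s) :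
    Steps (w + 2 * Fintype.card ι) n s (t ∪ Set.range c) :=
  h.par ((id_range n c).mono_left (by rintro _ ⟨i, rfl⟩; exact hc i))

theorem carry {w n : ℕ} {s t : Set (X → ℝ)} (h : Steps w n s t)
    {f : X → ℝ} (hf : f ∈ aff s) : Steps (w + 2) n s (insert f t) := by
  have := h.carry_range (fun _ : Unit => f) fun _ => hf
  simpa using this

theorem pad {w n m : ℕ} {s : Set (X → ℝ)} {f : X → ℝ} (h : Steps w n s {f}) (hnm : n ≤ m)
    (hw : 2 ≤ w) : Steps w m s {f} := by
  obtain ⟨k, rfl⟩ := Nat.exists_eq_add_of_le hnm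
  refine h.trans (mono_width (w := 2) ?_ hw)
  simpa using id_range k (fun _ : Unit => f)

theorem exists_mem_NNaux {d w n : ℕ} (hw : 1 ≤ w) {f : X → ℝ} {u : Fin d → X → ℝ}
    (h : Steps w n (Set.range u) {f}) :
    ∃ g ∈ NNaux 1 w n d, ∀ x, f x = g (fun j => u j x) 0 := by
  induction n generalizing d with
  | zero =>
    obtain ⟨a, c, hac⟩ := mem_aff_range (h rfl)
    exact ⟨fun y _ => (∑ j, a j * y j) + c, ⟨fun _ => a, fun _ => c, fun _ _ => rfl⟩, hac⟩
  | succ n ih =>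
    obtain ⟨v, hv, h⟩ := h
    obtain ⟨g, hg, hfg⟩ := ih h
    choose a c hac using fun i => mem_aff_range (hv i)
    refine ⟨_, ⟨w, hw, le_rfl, fun y i => (∑ j, a i j * y j) + c i, g,
      ⟨a, c, fun _ _ => rfl⟩, hg, rfl⟩, fun x => ?_⟩
    simp only [hfg, hac]

end Steps

end Steps

section Digits

variable {X : Type*}

theorem sum_range_ite_lt (a Q : ℕ) (h : a ≤ Q) :
    (∑ j ∈ Finset.range Q, if j < a then (1 : ℝ) else 0) = a := by
  rw [Finset.sum_ite, Finset.sum_const_zero, add_zero, Finset.sum_const, nsmul_eq_mul, mul_one]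
  congr 1
  rw [show (Finset.range Q).filter (· < a) = Finset.range a by ext; simp; omega]
  simp

/-- One layer computes the quotient by `P` of the integer part of `v`. -/
theorem Steps.div {v : X → ℝ} {m : X → ℕ} {η : ℝ} (hη : 0 < η) (h1 : ∀ x, m x ≤ v x)
    (h2 : ∀ x, v x ≤ m x + 1 - η) {P Q : ℕ} (hP : 0 < P) (hQ : ∀ x, m x < Q * P) :
    Steps (2 * Q) 1 {v} {fun x => ((m x / P : ℕ) : ℝ)} := by
  have hv : v ∈ aff {v} := mem_aff rfl
  refine Steps.mono_right (Steps.layer (ι := Fin Q ⊕ Fin Q)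
    (Sum.elim (fun j x => v x - ((j + 1 : ℕ) * P - η)) fun j x => v x - (j + 1 : ℕ) * P)
    ?_ (by simp [two_mul])) ?_
  · rintro (j | j)
    · exact sub_mem_aff hv (const_mem_aff _ _)
    · exact sub_mem_aff hv (const_mem_aff _ _)
  · rw [Set.singleton_subset_iff]
    have key : (fun x => ((m x / P : ℕ) : ℝ)) = fun x => ∑ j : Fin Q, η⁻¹ *
        (relu (v x - ((j + 1 : ℕ) * P - η)) - relu (v x - (j + 1 : ℕ) * P)) := by
      ext x
      rw [← sum_range_ite_lt (m x / P) Q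
        (Nat.le_of_lt ((Nat.div_lt_iff_lt_mul hP).2 (hQ x))), Finset.sum_range]
      refine Finset.sum_congr rfl fun j _ => ?_
      have e : (j : ℕ) < m x / P ↔ (j + 1 : ℕ) * P ≤ m x := by
        rw [← Nat.succ_le_iff, Nat.le_div_iff_mul_le hP]
      have a1 := h1 x
      have a2 := h2 x
      split_ifs with h
      · have h' : (((j + 1 : ℕ) * P : ℕ) : ℝ) ≤ m x := by exact_mod_cast e.1 h
        rw [Nat.cast_mul] at h'
        rw [relu_of_nonneg (by linarith), relu_of_nonneg (by linarith)]
        field_simp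
        ring
      · have h' : ((m x + 1 : ℕ) : ℝ) ≤ (((j + 1 : ℕ) * P : ℕ) : ℝ) := by
          exact_mod_cast Nat.lt_of_not_le fun h' => h (e.2 h')
        rw [Nat.cast_mul, Nat.cast_succ (m x)] at h'
        rw [relu_of_nonpos (by linarith), relu_of_nonpos (by linarith)]
        simp
    rw [key]
    refine sum_mem_aff (Finset.univ : Finset (Fin Q)) fun j _ => mul_mem_aff _
      (sub_mem_aff (mem_aff ⟨Sum.inl j, rfl⟩) (mem_aff ⟨Sum.inr j, rfl⟩))

/-- The remainder modulo `P` of the integer part of `v`, added to the fractional part of `v`, is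
computed by extracting `T` digits in base `Q`. -/
theorem Steps.mod {η : ℝ} (hη : 0 < η) {P Q : ℕ} (hP : 0 < P) (hQ0 : 0 < Q) (T : ℕ) {v : X → ℝ} {m : X → ℕ}
    (h1 : ∀ x, m x ≤ v x) (h2 : ∀ x, v x ≤ m x + 1 - η) (hQ : ∀ x, m x < Q ^ T * P) :
    Steps (2 * Q + 2) T {v} {fun x => v x - m x + (m x % P : ℕ)} := by
  induction T generalizing v m with
  | zero =>
    refine Steps.of_subset (Set.singleton_subset_iff.2 ?_)
    refine mem_aff (Set.mem_singleton_iff.2 ?_)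
    ext x
    rw [Nat.mod_eq_of_lt (by simpa using hQ x)]
    ring
  | succ T ih =>
    have hPT : 0 < Q ^ T * P := by positivity
    rw [add_comm T 1]
    have hm : ∀ x, (m x : ℝ) = (Q ^ T * P : ℕ) * (m x / (Q ^ T * P) : ℕ) +
        (m x % (Q ^ T * P) : ℕ) := fun x => by exact_mod_cast (Nat.div_add_mod _ _).symm
    refine ((Steps.div hη h1 h2 hPT fun x => (hQ x).trans_eq (by ring)).carry
      (mem_aff rfl)).trans (((ih (v := fun x => v x - (Q ^ T * P : ℕ) * (m x / (Q ^ T * P) : ℕ))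
        (m := fun x => m x % (Q ^ T * P)) (fun x => ?_) (fun x => ?_)
          fun x => Nat.mod_lt _ hPT).mono_left ?_).mono_right ?_)
    · linarith [h1 x, hm x]
    · linarith [h2 x, hm x]
    · rw [Set.singleton_subset_iff]
      exact sub_mem_aff (mem_aff (by simp)) (mul_mem_aff _ (mem_aff (by simp)))
    · rw [Set.singleton_subset_iff]
      apply mem_aff
      rw [Set.mem_singleton_iff]
      ext x
      rw [Nat.mod_mod_of_dvd _ (Dvd.intro_left _ rfl)]
      linarith [hm x]

/-- The number of times a walk with steps `h 0, …, h (R - 1)` lands on `y`, not counting the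
landings of steps of length `K`. -/
def hits (K : ℕ) : ℕ → (ℕ → ℕ) → ℤ → ℕ
  | 0, _, _ => 0
  | R + 1, h, y => (if h 0 < K ∧ y = h 0 then 1 else 0) +
      hits K R (fun j => h (j + 1)) (y - h 0)

/-- The number with base `H` digits `h 0, …, h (R - 1)`. -/
def encode (H : ℕ) : ℕ → (ℕ → ℕ) → ℕ
  | 0, _ => 0
  | R + 1, h => h 0 * H ^ R + encode H R fun j => h (j + 1)

theorem encode_lt {H : ℕ} (R : ℕ) {h : ℕ → ℕ} (hH : ∀ j, h j < H) : encode H R h < H ^ R := by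
  induction R generalizing h with
  | zero => simp [encode]
  | succ R ih =>
    have h1 := ih fun j => hH (j + 1)
    have h2 : (h 0 + 1) * H ^ R ≤ H * H ^ R := Nat.mul_le_mul_right _ (hH 0)
    rw [encode, pow_succ']
    linarith

theorem relu_one_sub {K h : ℕ} (hK : h ≤ K) (y : ℤ) :
    relu (1 - (relu y + relu (-y)) - relu (h - (K - 1))) = if h < K ∧ y = 0 then (1 : ℝ) else 0 := by
  rw [relu_add_relu_neg]
  rcases hK.lt_or_eq with h1 | rfl
  · have : (h : ℝ) + 1 ≤ K := by exact_mod_cast h1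
    rw [relu_of_nonpos (t := (h : ℝ) - (K - 1)) (by linarith)]
    by_cases hy : y = 0
    · simp [hy, h1, relu]
    · have : (1 : ℝ) ≤ |(y : ℝ)| := by exact_mod_cast Int.one_le_abs hy
      simp only [hy, and_false, if_false]
      exact relu_of_nonpos (by linarith)
  · simp only [lt_irrefl, false_and, if_false]
    refine relu_of_nonpos ?_
    rw [relu_of_nonneg (by linarith)]
    linarith [abs_nonneg (y : ℝ)]

/-- Decoding an encoded walk, adding the number of hits to `acc`. -/
theorem Steps.decode {K Q T : ℕ} (hQ0 : 0 < Q) (hKQ : K < Q ^ T) (R : ℕ) {h : X → ℕ → ℕ} (hh : ∀ x j, h x j ≤ K)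
    (y : X → ℤ) (acc : X → ℝ) :
    Steps (2 * Q + 10) (R * (T + 2)) {fun x => (encode (Q ^ T) R (h x) : ℝ), fun x => (y x : ℝ), acc}
      {fun x => acc x + hits K R (h x) (y x)} := by
  induction R generalizing h y acc with
  | zero =>
    rw [zero_mul]
    refine Steps.of_subset (Set.singleton_subset_iff.2 (mem_aff ?_))
    simp [hits]
  | succ R ih =>
    have hH : 0 < Q ^ T := by omega
    set z : X → ℝ := fun x => (encode (Q ^ T) (R + 1) (h x) : ℝ) with hz
    set z' : X → ℝ := fun x => (encode (Q ^ T) R (fun j => h x (j + 1)) : ℝ) with hz'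
    have hlt : ∀ x, encode (Q ^ T) R (fun j => h x (j + 1)) < (Q ^ T) ^ R := fun x =>
      encode_lt R fun j => (hh x _).trans_lt hKQ
    have hzz : ∀ x, z x = h x 0 * ((Q : ℝ) ^ T) ^ R + z' x := fun x => by simp [hz, hz', encode]
    have hpos : (0 : ℝ) < ((Q : ℝ) ^ T) ^ R := by exact_mod_cast pow_pos hH R
    have e1 : Steps (2 * Q + 10) T {z, fun x => (y x : ℝ), acc}
        {z', z, fun x => (y x : ℝ), acc} := by
      have := (((((Steps.mod one_pos (v := z) (P := (Q ^ T) ^ R) (Q := Q) (by positivity) hQ0 T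
        (m := fun x => encode (Q ^ T) (R + 1) (h x)) (fun x => le_rfl) (fun x => by simp [hz])
        fun x => (encode_lt (R + 1) fun j => (hh x _).trans_lt hKQ).trans_eq
          (pow_succ' _ _)).mono_left
          (s' := {z, fun x => (y x : ℝ), acc}) ?_).carry (f := z) (mem_aff (by simp))).carry
          (f := fun x => (y x : ℝ)) (mem_aff (by simp))).carry (f := acc)
            (mem_aff (by simp))).mono_width (w' := 2 * Q + 10) (by omega)
      · refine this.mono_right (Set.Subset.trans ?_ (subset_aff _))
        rintro f (rfl | rfl | rfl | rfl)
        · right; right; right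
          rw [Set.mem_singleton_iff]
          ext x
          rw [encode, mul_comm, Nat.mul_add_mod, Nat.mod_eq_of_lt (hlt x)]
          simp [hz', hz, encode]
          ring
        all_goals simp
      · exact Set.Subset.trans (by simp) (subset_aff _)
    set s₁ : Set (X → ℝ) := {z', z, fun x => (y x : ℝ), acc} with hs₁
    have hh0 : (fun x => (h x 0 : ℝ)) ∈ aff s₁ := by
      have := mul_mem_aff (((Q : ℝ) ^ T) ^ R)⁻¹ (sub_mem_aff (s := s₁) (f := z) (g := z')
        (mem_aff (by simp [hs₁])) (mem_aff (by simp [hs₁])))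
      convert this using 2 with x
      rw [hzz]
      field_simp
      ring
    have hy' : (fun x => ((y x - h x 0 : ℤ) : ℝ)) ∈ aff s₁ := by
      have := sub_mem_aff (mem_aff (s := s₁) (f := fun x => (y x : ℝ)) (by simp [hs₁])) hh0
      simpa using this
    set y' : X → ℝ := fun x => ((y x - h x 0 : ℤ) : ℝ) with hy'def
    have hacc : acc ∈ aff s₁ := mem_aff (by simp [hs₁])
    set u : Fin 3 → X → ℝ := ![y', fun x => -y' x, fun x => h x 0 - (K - 1)] with hu
    have e2 := (((Steps.layer (w := 3) (s := s₁) u (by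
      intro i
      fin_cases i
      · exact hy'
      · exact neg_mem_aff hy'
      · exact sub_mem_aff hh0 (const_mem_aff _ _)) (by simp)).carry (f := acc)
        hacc).carry (f := y') hy').carry
        (f := z') (mem_aff (by simp [hs₁]))
    set s₂ := insert z' (insert y' (insert acc (Set.range fun i x => relu (u i x)))) with hs₂
    have hr : ∀ i, (fun x => relu (u i x)) ∈ aff s₂ := fun i =>
      mem_aff (by right; right; right; exact ⟨i, rfl⟩)
    have e3 := (((Steps.layer (w := 1) (s := s₂) (fun (_ : Unit) x =>
        1 - (relu (u 0 x) + relu (u 1 x)) - relu (u 2 x))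
      (fun _ => sub_mem_aff (sub_mem_aff (const_mem_aff _ _) (add_mem_aff (hr 0) (hr 1))) (hr 2))
      (by simp)).carry (f := acc)
        (mem_aff (by simp [hs₂]))).carry (f := y') (mem_aff (by simp [hs₂]))).carry
        (f := z') (mem_aff (by simp [hs₂]))
    have e4 := ih (h := fun x j => h x (j + 1)) (fun x j => hh x _) (fun x => y x - h x 0)
      (fun x => acc x + if h x 0 < K ∧ y x - h x 0 = 0 then (1 : ℝ) else 0)
    rw [show (R + 1) * (T + 2) = T + (1 + (1 + R * (T + 2))) by ring]
    refine e1.trans ((e2.mono_width (by omega)).trans ((e3.mono_width (by omega)).trans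
      ((e4.mono_left ?_).mono_right ?_)))
    · rintro f (rfl | rfl | rfl)
      · exact mem_aff (by simp [hz'])
      · exact mem_aff (by simp [hy'def])
      · refine add_mem_aff (mem_aff (by simp)) (mem_aff ?_)
        right; right; right
        refine ⟨(), ?_⟩
        ext x
        simpa [hu, hy'def] using relu_one_sub (hh x 0) (y x - h x 0)
    · refine Set.Subset.trans ?_ (subset_aff _)
      rw [Set.singleton_subset_iff, Set.mem_singleton_iff]
      ext x
      simp only [hits, sub_eq_zero]
      push_cast
      ring

end Digits

section Lookup

variable {X : Type*}

theorem hits_const (K R : ℕ) (y : ℤ) : hits K R (fun _ => K) y = 0 := by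
  induction R generalizing y with
  | zero => rfl
  | succ R ih => rw [hits, ih, if_neg (by simp)]

/-- A finitely supported sequence of natural numbers is the hit count of a walk. -/
theorem exists_walk {K : ℕ} (hK : 0 < K) (E R t : ℕ) (x : ℕ → ℕ) (hx1 : ∀ n < t, x n = 0)
    (hx2 : ∀ n, E ≤ n → x n = 0) (hR : ∑ n ∈ Finset.range E, x n + (E - t) / K ≤ R) :
    ∃ h : ℕ → ℕ, (∀ j, h j ≤ K) ∧ ∀ n : ℕ, hits K R h ((n : ℤ) - t) = x n := by
  by_cases hz : ∀ n, x n = 0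
  · exact ⟨fun _ => K, fun _ => le_rfl, fun n => by rw [hits_const, hz]⟩
  push Not at hz
  induction R generalizing t x with
  | zero =>
    obtain ⟨n, hn⟩ := hz
    have h0 : ∑ n ∈ Finset.range E, x n = 0 :=
      Nat.le_zero.1 ((Nat.le_add_right _ _).trans hR)
    refine absurd ?_ hn
    by_cases hnE : n < E
    · exact Finset.sum_eq_zero_iff.1 h0 n (by simpa using hnE)
    · exact hx2 n (by omega)
  | succ R ih =>
    have ih' : ∀ (t : ℕ) (x : ℕ → ℕ), (∀ n < t, x n = 0) → (∀ n, E ≤ n → x n = 0) →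
        ∑ n ∈ Finset.range E, x n + (E - t) / K ≤ R →
        ∃ h : ℕ → ℕ, (∀ j, h j ≤ K) ∧ ∀ n : ℕ, hits K R h ((n : ℤ) - t) = x n := by
      intro t x h1 h2 h3
      by_cases hz : ∀ n, x n = 0
      · exact ⟨fun _ => K, fun _ => le_rfl, fun n => by rw [hits_const, hz]⟩
      · exact ih t x h1 h2 h3 (by push Not at hz; exact hz)
    have hn0 := Nat.find_spec hz
    have hmin : ∀ n < Nat.find hz, x n = 0 := fun n hn => by simpa using Nat.find_min hz hn
    set n₀ := Nat.find hz
    have htn : t ≤ n₀ := Nat.le_of_not_lt fun h => hn0 (hx1 _ h)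
    have hnE : n₀ < E := Nat.lt_of_not_le fun h => hn0 (hx2 _ h)
    rcases lt_or_ge (n₀ - t) K with hlt | hge
    · have hupd : ∀ n, x n = (if n = n₀ then 1 else 0) + (x n - if n = n₀ then 1 else 0) := by
        intro n
        split_ifs with h
        · subst h; omega
        · omega
      have hsum : ∑ n ∈ Finset.range E, x n =
          1 + ∑ n ∈ Finset.range E, (x n - if n = n₀ then 1 else 0) := by
        rw [Finset.sum_congr rfl fun n _ => hupd n, Finset.sum_add_distrib,
          Finset.sum_ite_eq' (Finset.range E) n₀ fun _ => 1, if_pos (by simpa using hnE)]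
      have hdiv : (E - n₀) / K ≤ (E - t) / K := Nat.div_le_div_right (by omega)
      obtain ⟨h, hhK, hh⟩ := ih' n₀ (fun n => x n - if n = n₀ then 1 else 0)
        (fun n hn => by simp [hmin n hn]) (fun n hn => by simp [hx2 n hn])
        (by omega)
      refine ⟨fun j => Nat.casesOn j (n₀ - t) h, fun j => ?_, fun n => ?_⟩
      · cases j
        · exact hlt.le
        · exact hhK _
      · change (if n₀ - t < K ∧ (n : ℤ) - t = (n₀ - t : ℕ) then 1 else 0) +
          hits K R h ((n : ℤ) - t - (n₀ - t : ℕ)) = x n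
        rw [show (n : ℤ) - t - ((n₀ - t : ℕ) : ℤ) = n - n₀ by omega, hh]
        conv_rhs => rw [hupd n]
        congr 1
        have : ((n : ℤ) - t = ((n₀ - t : ℕ) : ℤ)) ↔ n = n₀ := by omega
        simp [hlt, this]
    · have hdiv : (E - t) / K = (E - (t + K)) / K + 1 := by
        rw [Nat.div_eq_sub_div hK (by omega), Nat.sub_sub]
      obtain ⟨h, hhK, hh⟩ := ih' (t + K) x (fun n hn => hmin n (by omega)) hx2 (by omega)
      refine ⟨fun j => Nat.casesOn j K h, fun j => ?_, fun n => ?_⟩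
      · cases j
        · exact le_rfl
        · exact hhK _
      · change (if K < K ∧ (n : ℤ) - t = K then 1 else 0) + hits K R h ((n : ℤ) - t - K) = x n
        rw [show (n : ℤ) - t - (K : ℤ) = n - (t + K : ℕ) by push_cast; ring, hh]
        simp

theorem apply_min_add (f : ℕ → ℝ) (s a w : ℕ) :
    f (min s (a + w)) = f (min s a) + ∑ k ∈ Finset.range w,
      (f (a + k + 1) - f (a + k)) * if a + k + 1 ≤ s then 1 else 0 := by
  induction w with
  | zero => simp
  | succ w ih =>
    rw [Finset.sum_range_succ, ← add_assoc (f (min s a)), ← ih, ← add_assoc a w 1]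
    split_ifs with h
    · rw [min_eq_right (by omega), min_eq_right (by omega)]
      ring_nf
    · rw [min_eq_left (by omega), min_eq_left (by omega)]
      ring

theorem relu_add_one_sub_relu (n t : ℕ) :
    relu ((n : ℝ) - t + 1) - relu ((n : ℝ) - t) = if t ≤ n then 1 else 0 := by
  split_ifs with h
  · have : (t : ℝ) ≤ n := by exact_mod_cast h
    rw [relu_of_nonneg (by linarith), relu_of_nonneg (by linarith)]
    ring
  · have : (n : ℝ) + 1 ≤ t := by exact_mod_cast Nat.lt_of_not_le h
    rw [relu_of_nonpos (by linarith), relu_of_nonpos (by linarith)]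
    ring

/-- Functions that factor through a slowly increasing function of an integer are computed by adding
up their jumps, `w` of them in each layer. -/
theorem Steps.jumps {ι : Type*} [Fintype ι] (w L : ℕ) (ν : X → ℕ) {σ : ℕ → ℕ} (hσ : Monotone σ)
    (hub : ∀ ρ, ∃ n, ρ ≤ σ n) (ψ : ι → ℕ → ℝ) :
    Steps (2 * w + 2 * Fintype.card ι + 2) L {fun x => (ν x : ℝ)}
      (insert (fun x => (ν x : ℝ)) (Set.range fun i x => ψ i (min (σ (ν x)) (w * L)))) := by
  induction L with
  | zero =>
    refine Steps.of_subset ?_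
    rintro f (rfl | ⟨i, rfl⟩)
    · exact mem_aff rfl
    · simpa using const_mem_aff _ (ψ i 0)
  | succ L ih =>
    set s := insert (fun x => (ν x : ℝ)) (Set.range fun i x => ψ i (min (σ (ν x)) (w * L)))
      with hs
    have hν : (fun x => (ν x : ℝ)) ∈ aff s := mem_aff (by simp [hs])
    have hfind : ∀ ρ n, Nat.find (hub ρ) ≤ n ↔ ρ ≤ σ n := fun ρ n =>
      ⟨fun h => (Nat.find_spec (hub ρ)).trans (hσ h), fun h => Nat.find_min' _ h⟩
    have e := ((Steps.layer (ι := Fin w ⊕ Fin w) (w := 2 * w) (s := s)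
      (Sum.elim (fun k x => (ν x : ℝ) - Nat.find (hub (w * L + k + 1)) + 1)
        fun k x => (ν x : ℝ) - Nat.find (hub (w * L + k + 1))) (by
          rintro (k | k)
          · exact add_mem_aff (sub_mem_aff hν (const_mem_aff _ _)) (const_mem_aff _ _)
          · exact sub_mem_aff hν (const_mem_aff _ _)) (by simp [two_mul])).carry_range
      (fun i x => ψ i (min (σ (ν x)) (w * L))) fun i => mem_aff (by simp [hs])).carry hν
    refine ih.trans (e.mono_right ?_)
    rintro f (rfl | ⟨i, rfl⟩)
    · exact mem_aff (by simp)
    · have key : (fun x => ψ i (min (σ (ν x)) (w * (L + 1)))) = fun x =>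
          ψ i (min (σ (ν x)) (w * L)) + ∑ k : Fin w, (ψ i (w * L + k + 1) - ψ i (w * L + k)) *
            (relu ((ν x : ℝ) - Nat.find (hub (w * L + k + 1)) + 1) -
              relu ((ν x : ℝ) - Nat.find (hub (w * L + k + 1)))) := by
        ext x
        rw [Nat.mul_succ, apply_min_add (ψ i), Finset.sum_range]
        simp only [relu_add_one_sub_relu, hfind]
      dsimp only
      rw [key]
      refine add_mem_aff (mem_aff (by simp)) (sum_mem_aff _ fun k _ => mul_mem_aff _
        (sub_mem_aff (mem_aff ?_) (mem_aff ?_)))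
      · exact Or.inr (Or.inl ⟨Sum.inl k, rfl⟩)
      · exact Or.inr (Or.inl ⟨Sum.inr k, rfl⟩)

theorem relu_gate {c Kc : ℝ} (hc0 : 0 ≤ c) (hc : c ≤ Kc) (n t e : ℕ) :
    relu (relu c - Kc * (relu ((t : ℝ) - n) + relu ((n : ℝ) + 1 - e))) =
      if t ≤ n ∧ n < e then c else 0 := by
  rw [relu_of_nonneg hc0]
  split_ifs with h
  · have h1 : (t : ℝ) ≤ n := by exact_mod_cast h.1
    have h2 : (n : ℝ) + 1 ≤ e := by exact_mod_cast h.2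
    rw [relu_of_nonpos (t := (t : ℝ) - n) (by linarith),
      relu_of_nonpos (t := (n : ℝ) + 1 - e) (by linarith), add_zero, mul_zero, sub_zero, relu_of_nonneg hc0]
  · refine relu_of_nonpos ?_
    have h1 : 0 ≤ relu ((t : ℝ) - n) := le_max_right _ _
    have h2 : 0 ≤ relu ((n : ℝ) + 1 - e) := le_max_right _ _
    have h3 : 1 ≤ relu ((t : ℝ) - n) + relu ((n : ℝ) + 1 - e) := by
      by_cases ht : t ≤ n
      · have : (e : ℝ) ≤ n := by exact_mod_cast Nat.le_of_not_lt fun h' => h ⟨ht, h'⟩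
        have : (n : ℝ) + 1 - e ≤ relu ((n : ℝ) + 1 - e) := le_max_left _ _
        linarith
      · have : (n : ℝ) + 1 ≤ t := by exact_mod_cast Nat.lt_of_not_le ht
        have : (t : ℝ) - n ≤ relu ((t : ℝ) - n) := le_max_left _ _
        linarith
    nlinarith

/-- A function that factors through a monotone function `r` with less than `w * (w * L)` values is
computed with width of order `w` and depth of order `L`. -/
theorem Steps.lookup {w L : ℕ} (ν : X → ℕ) {r : ℕ → ℕ} (hr : Monotone r)
    (hub : ∀ ρ, ∃ n, ρ ≤ r n) (hrL : ∀ x, r (ν x) < w * (w * L)) {φ : ℕ → ℕ}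
    (hφ : Function.FactorsThrough φ r) :
    Steps (8 * w + 2) (L + 2) {fun x => (ν x : ℝ)} {fun x => (φ (ν x) : ℝ)} := by
  rcases Nat.eq_zero_or_pos w with rfl | hw
  · have hX : IsEmpty X := ⟨fun x => by simpa using hrL x⟩
    have h0 : (fun x => (φ (ν x) : ℝ)) = fun x => (ν x : ℝ) := by
      ext x; exact (hX.false x).elim
    rw [h0]
    simpa using Steps.id_range (L + 2) fun (_ : Unit) x => (ν x : ℝ)
  have hfind : ∀ ρ n, Nat.find (hub ρ) ≤ n ↔ ρ ≤ r n := fun ρ n =>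
      ⟨fun h => (Nat.find_spec (hub ρ)).trans (hr h), fun h => Nat.find_min' _ h⟩
  set c : ℕ → ℕ := Function.extend r φ 0
  have hc : ∀ n, c (r n) = φ n := fun n => hφ.extend_apply 0 n
  set Kc : ℝ := ∑ ρ ∈ Finset.range (w * (w * L)), (c ρ : ℝ)
  have hKc : ∀ ρ < w * (w * L), (c ρ : ℝ) ≤ Kc := fun ρ hρ =>
    Finset.single_le_sum (f := fun ρ => (c ρ : ℝ)) (fun _ _ => Nat.cast_nonneg _)
      (Finset.mem_range.2 hρ)
  have hσ : Monotone fun n => r n / w := fun a b h => Nat.div_le_div_right (hr h)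
  have hσub : ∀ ρ, ∃ n, ρ ≤ r n / w := fun ρ => by
    obtain ⟨n, hn⟩ := hub (ρ * w)
    exact ⟨n, (Nat.le_div_iff_mul_le hw).2 hn⟩
  have hσL : ∀ x, r (ν x) / w < w * L := fun x =>
    (Nat.div_lt_iff_lt_mul hw).2 ((hrL x).trans_eq (by ring))
  have e1 := Steps.jumps (ι := Fin w ⊕ Fin w ⊕ Fin w) w L ν hσ hσub
    (Sum.elim (fun v ρ => (Nat.find (hub (ρ * w + v)) : ℝ))
      (Sum.elim (fun v ρ => (Nat.find (hub (ρ * w + v + 1)) : ℝ)) fun v ρ => (c (ρ * w + v) : ℝ)))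
  simp only [min_eq_left (hσL _).le] at e1
  set s := insert (fun x => (ν x : ℝ)) (Set.range fun (i : Fin w ⊕ Fin w ⊕ Fin w) x =>
    (Sum.elim (fun v ρ => (Nat.find (hub (ρ * w + v)) : ℝ))
      (Sum.elim (fun v ρ => (Nat.find (hub (ρ * w + v + 1)) : ℝ)) fun v ρ => (c (ρ * w + v) : ℝ))
        : Fin w ⊕ Fin w ⊕ Fin w → ℕ → ℝ) i (r (ν x) / w)) with hs
  have hν : (fun x => (ν x : ℝ)) ∈ aff s := mem_aff (by simp [hs])
  have e2 := Steps.layer (ι := Fin w ⊕ Fin w ⊕ Fin w) (w := 8 * w + 2) (s := s)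
    (Sum.elim (fun v x => (Nat.find (hub (r (ν x) / w * w + v)) : ℝ) - ν x)
      (Sum.elim (fun v x => (ν x : ℝ) + 1 - Nat.find (hub (r (ν x) / w * w + v + 1)))
        fun v x => (c (r (ν x) / w * w + v) : ℝ)))
    (by
      rintro (v | v | v)
      · exact sub_mem_aff (mem_aff (Or.inr ⟨Sum.inl v, rfl⟩)) hν
      · exact sub_mem_aff (add_mem_aff hν (const_mem_aff _ _))
          (mem_aff (Or.inr ⟨Sum.inr (Sum.inl v), rfl⟩))
      · exact mem_aff (Or.inr ⟨Sum.inr (Sum.inr v), rfl⟩)) (by simp; omega)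
  have e3 := e2.trans (Steps.layer (ι := Fin w) (w := 8 * w + 2) (fun v x =>
    relu (c (r (ν x) / w * w + v) : ℝ) - Kc *
      (relu ((Nat.find (hub (r (ν x) / w * w + v)) : ℝ) - ν x) +
        relu ((ν x : ℝ) + 1 - Nat.find (hub (r (ν x) / w * w + v + 1))))) (fun v =>
      sub_mem_aff (mem_aff ⟨Sum.inr (Sum.inr v), rfl⟩) (mul_mem_aff _
        (add_mem_aff (mem_aff ⟨Sum.inl v, rfl⟩) (mem_aff ⟨Sum.inr (Sum.inl v), rfl⟩))))
      (by simp; omega))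
  refine (e1.mono_width (by simp; omega)).trans (e3.mono_right ?_)
  rw [Set.singleton_subset_iff]
  have key : (fun x => (φ (ν x) : ℝ)) = fun x => ∑ v : Fin w, relu (
      relu (c (r (ν x) / w * w + v) : ℝ) - Kc *
      (relu ((Nat.find (hub (r (ν x) / w * w + v)) : ℝ) - ν x) +
        relu ((ν x : ℝ) + 1 - Nat.find (hub (r (ν x) / w * w + v + 1))))) := by
    ext x
    have hlt : ∀ v : Fin w, r (ν x) / w * w + v < w * (w * L) := fun v => by
      have := Nat.mul_le_mul_right w (Nat.succ_le_of_lt (hσL x))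
      have := v.2
      rw [Nat.succ_mul] at *
      linarith
    simp only [relu_gate (Nat.cast_nonneg _) (hKc _ (hlt _))]
    have hdm := Nat.div_add_mod' (r (ν x)) w
    rw [Finset.sum_eq_single (⟨r (ν x) % w, Nat.mod_lt _ hw⟩ : Fin w)]
    · simp only [hdm]
      rw [if_pos, hc]
      exact ⟨(hfind _ _).2 le_rfl, Nat.lt_of_not_le fun h => by have := (hfind _ _).1 h; omega⟩
    · intro v _ hv
      rw [if_neg]
      rintro ⟨h1, h2⟩
      refine hv (Fin.ext ?_)
      have h1 := (hfind _ _).1 h1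
      have h2 := mt (hfind _ _).2 (not_le.2 h2)
      change (v : ℕ) = r (ν x) % w
      omega
    · simp
  rw [key]
  exact sum_mem_aff _ fun v _ => mem_aff ⟨v, rfl⟩

end Lookup

section Sparse

variable {X : Type*}

/-- Within a block on which the accumulated cost stays in a range of length `S`, the remainders
modulo `S` are the hit counts of a walk with `2 * S` steps. -/
theorem exists_walk_block {K S t E : ℕ} (hK : 0 < K) (hS : 0 < S) (htE : t < E) (a : ℕ → ℕ)
    (hcost : ∑ m ∈ Finset.range (E - 1), a m + (E - 1) / K <
      ∑ m ∈ Finset.range t, a m + t / K + S) :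
    ∃ h : ℕ → ℕ, (∀ j, h j ≤ K) ∧
      ∀ n : ℕ, t ≤ n → n < E → hits K (2 * S) h ((n : ℤ) - t) = a n % S := by
  obtain ⟨e, rfl⟩ : ∃ e, E = e + 1 := ⟨E - 1, by omega⟩
  rw [Nat.add_sub_cancel] at hcost
  set x : ℕ → ℕ := fun n => if t ≤ n ∧ n < e + 1 then a n % S else 0 with hx
  have hxa : ∀ n, x n ≤ a n := fun n => by
    simp only [hx]
    split_ifs
    exacts [Nat.mod_le _ _, Nat.zero_le _]
  have hsum : ∀ e ≥ t, ∑ n ∈ Finset.range e, x n + ∑ n ∈ Finset.range t, a n ≤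
      ∑ n ∈ Finset.range e, a n := by
    intro e he
    induction e, he using Nat.le_induction with
    | base =>
      rw [Finset.sum_eq_zero, zero_add]
      intro n hn
      have := Finset.mem_range.1 hn
      simp only [hx]
      rw [if_neg (by omega)]
    | succ e _ ih =>
      rw [Finset.sum_range_succ, Finset.sum_range_succ]
      have := hxa e
      omega
  have hxe : x e < S := by
    simp only [hx]
    split_ifs
    exacts [Nat.mod_lt _ hS, hS]
  have hte : t / K ≤ e / K := Nat.div_le_div_right (by omega)
  have hdiv : (e + 1 - t) / K ≤ e / K + 1 - t / K := by
    refine Nat.div_le_of_le_mul ?_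
    have h1 := Nat.div_mul_le_self t K
    have h2 := Nat.lt_div_mul_add (a := e) hK
    rw [Nat.mul_sub, mul_add, mul_comm K, mul_comm K (t / K)]
    omega
  obtain ⟨h, hhK, hh⟩ := exists_walk hK (e + 1) (2 * S) t x
    (fun n hn => by simp only [hx]; rw [if_neg (by omega)])
    (fun n hn => by simp only [hx]; rw [if_neg (by omega)]) (by
      have := hsum e (by omega)
      rw [Finset.sum_range_succ]
      generalize (e + 1 - t) / K = d at *
      generalize e / K = e' at *
      generalize t / K = t' at *
      omega)
  refine ⟨h, hhK, fun n h1 h2 => ?_⟩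
  rw [hh]
  simp only [hx]
  rw [if_pos ⟨h1, h2⟩]

/-- A network computing a sequence of natural numbers with sum at most `M`. -/
theorem Steps.sparse {N M S T K Q w : ℕ} (hS : 0 < S) (hT : 0 < T) (hK : 0 < K) (hw0 : 0 < w)
    (hKQ : K < Q ^ T) (ν : X → ℕ) (hν : ∀ x, ν x < N) (a : ℕ → ℕ)
    (ha : ∑ n ∈ Finset.range N, a n ≤ M) (hN : N ≤ K * M) (hw : M ≤ w ^ 2 * S ^ 2 * T) :
    Steps (24 * w + 2 * Q + 20) (5 * S * T + 2 + 2 * S * (T + 2)) {fun x => (ν x : ℝ)}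
      {fun x => (a (ν x) : ℝ)} := by
  have hQ0 : 0 < Q := Nat.pos_of_ne_zero fun h => by simp [h, hT.ne'] at hKQ
  set F : ℕ → ℕ := fun n => ∑ m ∈ Finset.range n, a m + n / K with hF
  set G : ℕ → ℕ := fun n => ∑ m ∈ Finset.range n, a m / S with hG
  have hrange : ∀ {f : ℕ → ℕ} {i j : ℕ}, i ≤ j →
      ∑ m ∈ Finset.range i, f m ≤ ∑ m ∈ Finset.range j, f m := fun h =>
    Finset.sum_le_sum_of_subset (Finset.range_mono h)
  have hFm : Monotone F := fun i j h => Nat.add_le_add (hrange h) (Nat.div_le_div_right h)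
  have hGm : Monotone G := fun i j h => hrange h
  set r₁ : ℕ → ℕ := fun n => F n / S with hr₁
  have hr₁m : Monotone r₁ := fun i j h => Nat.div_le_div_right (hFm h)
  have hub₁ : ∀ ρ, ∃ n, ρ ≤ r₁ n := fun ρ => ⟨ρ * S * K, by
    refine (Nat.le_div_iff_mul_le hS).2 ?_
    simp only [hF]
    rw [Nat.mul_div_cancel _ hK]
    exact Nat.le_add_left _ _⟩
  set r : ℕ → ℕ := fun n => r₁ n + G n + G (n + 1) with hr
  have hrm : Monotone r := fun i j h =>
    Nat.add_le_add (Nat.add_le_add (hr₁m h) (hGm h)) (hGm (Nat.succ_le_succ h))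
  have hub : ∀ ρ, ∃ n, ρ ≤ r n := fun ρ => by
    obtain ⟨n, hn⟩ := hub₁ ρ
    exact ⟨n, by simp only [hr]; omega⟩
  have hfac : ∀ i j, r i = r j → r₁ i = r₁ j ∧ a i / S = a j / S := by
    have main : ∀ i j, i ≤ j → r i = r j → r₁ i = r₁ j ∧ a i / S = a j / S := by
      intro i j h hij
      have h1 := hr₁m h
      have h2 := hGm h
      have h3 := hGm (Nat.succ_le_succ h)
      have h4 : G (i + 1) = G i + a i / S := Finset.sum_range_succ _ _
      have h5 : G (j + 1) = G j + a j / S := Finset.sum_range_succ _ _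
      simp only [hr, Nat.succ_eq_add_one] at *
      generalize a i / S = ai at *
      generalize a j / S = aj at *
      omega
    intro i j hij
    rcases le_total i j with h | h
    · exact main i j h hij
    · exact ⟨(main j i h hij.symm).1.symm, (main j i h hij.symm).2.symm⟩
  have hSG : ∀ n ≤ N, S * G n ≤ M := fun n hn => by
    refine le_trans ?_ ((hrange hn).trans ha)
    rw [hG, Finset.mul_sum]
    exact Finset.sum_le_sum fun m _ => Nat.mul_div_le _ _
  have hrL : ∀ x, r (ν x) < w * (w * (5 * S * T)) := by
    intro x
    have h1 : S * r₁ (ν x) ≤ F (ν x) := Nat.mul_div_le _ _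
    have h2 : ν x / K < M := (Nat.div_lt_iff_lt_mul hK).2 ((hν x).trans_le (by linarith))
    have h3 : ∑ m ∈ Finset.range (ν x), a m ≤ M := (hrange (hν x).le).trans ha
    have h4 := hSG (ν x) (hν x).le
    have h5 := hSG (ν x + 1) (hν x)
    have h6 : F (ν x) ≤ 2 * M := by simp only [hF]; omega
    have h7 : S * r (ν x) ≤ S * (4 * (w ^ 2 * S * T)) := by
      simp only [hr]
      nlinarith
    have h8 := Nat.le_of_mul_le_mul_left h7 hS
    have h9 : 0 < w ^ 2 * S * T := by positivity
    nlinarith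
  have hfind : ∀ ρ n, Nat.find (hub₁ ρ) ≤ n ↔ ρ ≤ r₁ n := fun ρ n =>
      ⟨fun h => (Nat.find_spec (hub₁ ρ)).trans (hr₁m h), fun h => Nat.find_min' _ h⟩
  have hwalk : ∀ ρ, ∃ h : ℕ → ℕ, (∀ j, h j ≤ K) ∧ ∀ n : ℕ, r₁ n = ρ →
      hits K (2 * S) h ((n : ℤ) - Nat.find (hub₁ ρ)) = a n % S := by
    intro ρ
    have hmem : ∀ n, r₁ n = ρ → Nat.find (hub₁ ρ) ≤ n ∧ n < Nat.find (hub₁ (ρ + 1)) := fun n hn =>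
      ⟨(hfind _ _).2 hn.ge, Nat.lt_of_not_le fun h => by have := (hfind _ _).1 h; omega⟩
    by_cases hex : ∃ n, r₁ n = ρ
    · obtain ⟨n, hn⟩ := hex
      obtain ⟨h1, h2⟩ := hmem n hn
      have h3 : ρ ≤ r₁ (Nat.find (hub₁ ρ)) := Nat.find_spec (hub₁ ρ)
      have h4 : r₁ (Nat.find (hub₁ (ρ + 1)) - 1) < ρ + 1 := Nat.lt_of_not_le fun h => by
        have := (hfind _ _).2 h
        omega
      obtain ⟨h, hhK, hh⟩ := exists_walk_block hK hS (h1.trans_lt h2) a (by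
        have h5 := (Nat.le_div_iff_mul_le hS).1 h3
        have h6 := (Nat.div_lt_iff_lt_mul hS).1 h4
        rw [Nat.succ_mul] at h6
        exact h6.trans_le (Nat.add_le_add_right h5 S))
      exact ⟨h, hhK, fun n hn => hh n (hmem n hn).1 (hmem n hn).2⟩
    · exact ⟨fun _ => 0, fun _ => Nat.zero_le _, fun n hn => absurd ⟨n, hn⟩ hex⟩
  choose h hhK hh using hwalk
  have e1 := Steps.lookup ν hrm hub hrL (φ := fun n => encode (Q ^ T) (2 * S) (h (r₁ n)))
    fun i j hij => by simp only [(hfac i j hij).1]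
  have e2 := Steps.lookup ν hrm hub hrL (φ := fun n => Nat.find (hub₁ (r₁ n)))
    fun i j hij => by simp only [(hfac i j hij).1]
  have e3 := Steps.lookup ν hrm hub hrL (φ := fun n => S * (a n / S))
    fun i j hij => by simp only [(hfac i j hij).2]
  have e4 := ((e1.par e2).par e3).carry (mem_aff rfl)
  have e5 := Steps.decode hQ0 hKQ (2 * S) (h := fun x => h (r₁ (ν x))) (fun x j => hhK _ _)
    (fun x => (ν x : ℤ) - Nat.find (hub₁ (r₁ (ν x)))) (fun x => ((S * (a (ν x) / S) : ℕ) : ℝ))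
  refine (e4.mono_width (by omega)).trans (((e5.mono_width (by omega)).mono_left ?_).mono_right ?_)
  · rintro f (rfl | rfl | rfl)
    · exact mem_aff (by simp)
    · push_cast
      exact sub_mem_aff (mem_aff (by simp)) (mem_aff (by simp))
    · exact mem_aff (by simp)
  · rw [Set.singleton_subset_iff]
    refine mem_aff (Set.mem_singleton_iff.2 ?_)
    ext x
    rw [hh _ _ rfl]
    exact_mod_cast (Nat.div_add_mod _ _).symm

end Sparse

section Products

variable {X : Type*}

/-- The continuous function, affine on each `[k, k + 1]` for `k < n`, interpolating `u`. -/
def interp (u : ℕ → ℝ) (n : ℕ) (v : ℝ) : ℝ :=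
  u 0 + ∑ k ∈ Finset.range n, (u (k + 1) - u k) * (relu (v - k) - relu (v - (k + 1 : ℕ)))

theorem interp_of_le (u : ℕ → ℝ) {n : ℕ} {v : ℝ} (h : (n : ℝ) ≤ v) : interp u n v = u n := by
  have : ∀ k ∈ Finset.range n, (u (k + 1) - u k) * (relu (v - k) - relu (v - (k + 1 : ℕ))) =
      u (k + 1) - u k := fun k hk => by
    have hk' : ((k + 1 : ℕ) : ℝ) ≤ n := by exact_mod_cast Finset.mem_range.1 hk
    rw [relu_of_nonneg (sub_nonneg.2 (hk'.trans h)), relu_of_nonneg]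
    · push_cast
      ring
    · push_cast at hk'
      linarith
  rw [interp, Finset.sum_congr rfl this, Finset.sum_range_sub]
  ring

theorem interp_eq (u : ℕ → ℝ) {n j : ℕ} {v : ℝ} (hj : j < n) (h1 : (j : ℝ) ≤ v) (h2 : v ≤ j + 1) :
    interp u n v = u j + (v - j) * (u (j + 1) - u j) := by
  induction n with
  | zero => omega
  | succ n ih =>
    have e : interp u (n + 1) v = interp u n v +
        (u (n + 1) - u n) * (relu (v - n) - relu (v - (n + 1 : ℕ))) := by
      rw [interp, Finset.sum_range_succ, interp, add_assoc]
    rcases Nat.lt_succ_iff_lt_or_eq.1 hj with h | rfl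
    · have h' : ((j + 1 : ℕ) : ℝ) ≤ n := by exact_mod_cast h
      push_cast at h'
      rw [e, ih h, relu_of_nonpos (by linarith), relu_of_nonpos (by push_cast; linarith)]
      ring
    · rw [e, interp_of_le u h1, relu_of_nonneg (by linarith),
        relu_of_nonpos (by push_cast; linarith)]
      ring

theorem sq_eq_interp {n : ℕ} (hn : 0 < n) {t : ℝ} (h0 : 0 ≤ t) (h1 : t ≤ 1) :
    (0 ≤ interp (fun k => ((k % 2 : ℕ) : ℝ)) n (n * t) ∧
      interp (fun k => ((k % 2 : ℕ) : ℝ)) n (n * t) ≤ 1) ∧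
    t ^ 2 = interp (fun k => (k : ℝ) ^ 2 / n ^ 2) n (n * t) -
      (interp (fun k => ((k % 2 : ℕ) : ℝ)) n (n * t) -
        interp (fun k => ((k % 2 : ℕ) : ℝ)) n (n * t) ^ 2) / n ^ 2 := by
  obtain ⟨j, hj, hj1, hj2⟩ : ∃ j < n, (j : ℝ) ≤ n * t ∧ n * t ≤ j + 1 := by
    have hn' : (0 : ℝ) < n := by exact_mod_cast hn
    rcases h1.lt_or_eq with h | rfl
    · refine ⟨⌊n * t⌋₊, (Nat.floor_lt (by positivity)).2 (by nlinarith),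
        Nat.floor_le (by positivity), (Nat.lt_floor_add_one _).le⟩
    · refine ⟨n - 1, by omega, ?_, ?_⟩ <;> rw [Nat.cast_pred hn] <;> linarith
  have hn' : (n : ℝ) ≠ 0 := by exact_mod_cast hn.ne'
  have key : (t : ℝ) ^ 2 * n ^ 2 = (n * t) ^ 2 := by ring
  rw [interp_eq _ hj hj1 hj2, interp_eq _ hj hj1 hj2]
  generalize (n : ℝ) * t = v at *
  have ht : t ^ 2 = v ^ 2 / n ^ 2 := by field_simp; linarith
  rcases Nat.mod_two_eq_zero_or_one j with e | e
  · have e' : (j + 1) % 2 = 1 := by omega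
    simp only [e, e']
    refine ⟨⟨by push_cast; linarith, by push_cast; linarith⟩, ?_⟩
    rw [ht]
    push_cast
    field_simp
    ring
  · have e' : (j + 1) % 2 = 0 := by omega
    simp only [e, e']
    refine ⟨⟨by push_cast; linarith, by push_cast; linarith⟩, ?_⟩
    rw [ht]
    push_cast
    field_simp
    ring

theorem interp_mem_aff {s : Set (X → ℝ)} (u : ℕ → ℝ) (n : ℕ) (v : X → ℝ)
    (h : ∀ k ≤ n, (fun x => relu (v x - (k : ℕ))) ∈ aff s) :
    (fun x => interp u n (v x)) ∈ aff s :=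
  add_mem_aff (const_mem_aff _ _) (sum_mem_aff _ fun k hk => mul_mem_aff _
    (sub_mem_aff (h k (Finset.mem_range.1 hk).le) (h (k + 1) (Finset.mem_range.1 hk))))

/-- Approximation of squares. -/
theorem Steps.sq {n : ℕ} (hn : 0 < n) (L : ℕ) (t acc : X → ℝ) (h0 : ∀ x, 0 ≤ t x)
    (h1 : ∀ x, t x ≤ 1) {c : ℝ} (hc : 0 ≤ c) :
    ∃ f : X → ℝ, (∀ x, |f x - (acc x + c * t x ^ 2)| ≤ c / (n ^ 2) ^ L) ∧
      Steps (n + 3) L {t, acc} {f} := by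
  induction L generalizing t acc c with
  | zero =>
    refine ⟨fun x => acc x + c * t x, fun x => ?_, Steps.of_subset (Set.singleton_subset_iff.2
      (add_mem_aff (mem_aff (by simp)) (mul_mem_aff _ (mem_aff (by simp)))))⟩
    have a0 := h0 x
    have a1 := h1 x
    have e : acc x + c * t x - (acc x + c * t x ^ 2) = c * (t x * (1 - t x)) := by ring
    rw [e, pow_zero, div_one, abs_of_nonneg (mul_nonneg hc (mul_nonneg a0 (by linarith)))]
    refine mul_le_of_le_one_right hc ?_
    nlinarith
  | succ L ih =>
    set w : X → ℝ := fun x => interp (fun k => ((k % 2 : ℕ) : ℝ)) n (n * t x) with hw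
    set p : X → ℝ := fun x => interp (fun k => (k : ℝ) ^ 2 / n ^ 2) n (n * t x) with hp
    have hsq := fun x => sq_eq_interp hn (h0 x) (h1 x)
    obtain ⟨f, hf, hS⟩ := ih w (fun x => acc x + c * p x - c / n ^ 2 * w x)
      (fun x => (hsq x).1.1) (fun x => (hsq x).1.2) (c := c / n ^ 2) (by positivity)
    refine ⟨f, fun x => ?_, ?_⟩
    · have e : acc x + c * t x ^ 2 =
          acc x + c * p x - c / n ^ 2 * w x + c / n ^ 2 * w x ^ 2 := by
        rw [(hsq x).2]
        ring
      rw [e, pow_succ' ((n : ℝ) ^ 2) L, ← div_div]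
      exact hf x
    · rw [add_comm L 1]
      refine Steps.trans (Steps.mono_right ((Steps.layer (ι := Fin (n + 1)) (w := n + 1)
        (fun k x => n * t x - (k : ℕ)) (fun k => sub_mem_aff (mul_mem_aff _ (mem_aff (by simp)))
          (const_mem_aff _ _)) (by simp)).carry (f := acc) (mem_aff (by simp))) ?_) hS
      have key : ∀ u : ℕ → ℝ, (fun x => interp u n (n * t x)) ∈ aff (insert acc
          (Set.range fun (k : Fin (n + 1)) x => relu (n * t x - (k : ℕ)))) := fun u =>
        interp_mem_aff u n (fun x => n * t x) fun k hk => mem_aff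
          (Set.mem_insert_of_mem _ ⟨⟨k, by omega⟩, rfl⟩)
      rintro f (rfl | rfl)
      · exact key _
      · exact sub_mem_aff (add_mem_aff (mem_aff (by simp)) (mul_mem_aff _ (key _)))
          (mul_mem_aff _ (key _))

/-- Approximation of products. -/
theorem Steps.mul {n : ℕ} (hn : 0 < n) (L : ℕ) {f g : X → ℝ} (hf : ∀ x, |f x| ≤ 1)
    (hg : ∀ x, |g x| ≤ 1) :
    ∃ h : X → ℝ, (∀ x, |h x| ≤ 1) ∧ (∀ x, |h x - f x * g x| ≤ 2 / (n ^ 2) ^ L) ∧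
      Steps (2 * n + 6) (L + 2) {f, g} {h} := by
  have hb : ∀ x, 0 ≤ |(f x + g x) / 2| ∧ |(f x + g x) / 2| ≤ 1 ∧
      0 ≤ |(f x - g x) / 2| ∧ |(f x - g x) / 2| ≤ 1 := fun x => by
    have := abs_le.1 (hf x)
    have := abs_le.1 (hg x)
    exact ⟨abs_nonneg _, abs_le.2 ⟨by linarith, by linarith⟩, abs_nonneg _,
      abs_le.2 ⟨by linarith, by linarith⟩⟩
  obtain ⟨u, hu, hSu⟩ := Steps.sq hn L (fun x => |(f x + g x) / 2|) (fun _ => 0)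
    (fun x => (hb x).1) (fun x => (hb x).2.1) zero_le_one
  obtain ⟨v, hv, hSv⟩ := Steps.sq hn L (fun x => |(f x - g x) / 2|) (fun _ => 0)
    (fun x => (hb x).2.2.1) (fun x => (hb x).2.2.2) zero_le_one
  refine ⟨fun x => relu (u x - v x + 1) - relu (u x - v x - 1) - 1, fun x => ?_, fun x => ?_, ?_⟩
  · rw [abs_le]
    unfold relu
    constructor
    · rcases max_cases (u x - v x + 1) 0 with h | h <;>
        rcases max_cases (u x - v x - 1) 0 with h' | h' <;> linarith
    · rcases max_cases (u x - v x + 1) 0 with h | h <;>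
        rcases max_cases (u x - v x - 1) 0 with h' | h' <;> linarith
  · have h1 := abs_le.1 (hu x)
    have h2 := abs_le.1 (hv x)
    rw [sq_abs] at h1 h2
    have hfg : |f x * g x| ≤ 1 := by
      rw [abs_mul]
      exact mul_le_one₀ (hf x) (abs_nonneg _) (hg x)
    have hfg' := abs_le.1 hfg
    have e2 : (2 : ℝ) / (n ^ 2) ^ L = 1 / (n ^ 2) ^ L + 1 / (n ^ 2) ^ L := by ring
    have e : f x * g x = ((f x + g x) / 2) ^ 2 - ((f x - g x) / 2) ^ 2 := by ring
    rw [e2, abs_le]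
    unfold relu
    constructor
    · rcases max_cases (u x - v x + 1) 0 with h | h <;>
        rcases max_cases (u x - v x - 1) 0 with h' | h' <;> linarith
    · rcases max_cases (u x - v x + 1) 0 with h | h <;>
        rcases max_cases (u x - v x - 1) 0 with h' | h' <;> linarith
  · have hfa : f ∈ aff {f, g} := mem_aff (by simp)
    have hga : g ∈ aff {f, g} := mem_aff (by simp)
    have s1 := Steps.layer (w := 4)
      (![fun x => 2⁻¹ * (f x + g x), fun x => -(2⁻¹ * (f x + g x)),
        fun x => 2⁻¹ * (f x - g x), fun x => -(2⁻¹ * (f x - g x))] : Fin 4 → X → ℝ)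
      (s := {f, g}) (fun i => by
        fin_cases i
        · exact mul_mem_aff _ (add_mem_aff hfa hga)
        · exact neg_mem_aff (mul_mem_aff _ (add_mem_aff hfa hga))
        · exact mul_mem_aff _ (sub_mem_aff hfa hga)
        · exact neg_mem_aff (mul_mem_aff _ (sub_mem_aff hfa hga))) (by simp)
    have s2 := hSu.union hSv
    have s3 := Steps.layer (w := 2)
      (![fun x => u x - v x + 1, fun x => u x - v x - 1] : Fin 2 → X → ℝ)
      (s := {u} ∪ {v}) (fun i => by
        fin_cases i
        · exact add_mem_aff (sub_mem_aff (mem_aff (by simp)) (mem_aff (by simp)))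
            (const_mem_aff _ _)
        · exact sub_mem_aff (sub_mem_aff (mem_aff (by simp)) (mem_aff (by simp)))
            (const_mem_aff _ _)) (by simp)
    rw [show L + 2 = 1 + L + 1 by ring]
    refine (((s1.mono_width (by omega)).trans ((s2.mono_width (by omega)).mono_left ?_)).trans
      (s3.mono_width (by omega))).mono_right ?_
    · rintro h ((rfl | rfl) | (rfl | rfl))
      · simp_rw [← relu_add_relu_neg]
        refine add_mem_aff (mem_aff ⟨0, ?_⟩) (mem_aff ⟨1, ?_⟩) <;> ext x <;> simp <;> ring_nf
      · exact const_mem_aff _ _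
      · simp_rw [← relu_add_relu_neg]
        refine add_mem_aff (mem_aff ⟨2, ?_⟩) (mem_aff ⟨3, ?_⟩) <;> ext x <;> simp <;> ring_nf
      · exact const_mem_aff _ _
    · rw [Set.singleton_subset_iff]
      exact sub_mem_aff (sub_mem_aff (mem_aff ⟨0, rfl⟩) (mem_aff ⟨1, rfl⟩)) (const_mem_aff _ _)

/-- Approximation of a function multiplied by a monomial. -/
theorem Steps.mul_prod {d n : ℕ} (hn : 0 < n) (L : ℕ) (t : Fin d → X → ℝ)
    (ht : ∀ j x, |t j x| ≤ 1) (γ : Fin d → ℕ) (J : Finset (Fin d)) {c : X → ℝ}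
    (hc : ∀ x, |c x| ≤ 1) :
    ∃ f : X → ℝ, (∀ x, |f x| ≤ 1) ∧
      (∀ x, |f x - c x * ∏ j ∈ J, t j x ^ γ j| ≤ (∑ j ∈ J, γ j) * (2 / (n ^ 2) ^ L)) ∧
      Steps (2 * n + 6 + 2 * d) ((∑ j ∈ J, γ j) * (L + 2)) (insert c (Set.range t))
        (insert f (Set.range t)) := by
  have step : ∀ (c : X → ℝ) (_ : ∀ x, |c x| ≤ 1) (j : Fin d) (m : ℕ),
      ∃ f : X → ℝ, (∀ x, |f x| ≤ 1) ∧
      (∀ x, |f x - c x * t j x ^ m| ≤ m * (2 / (n ^ 2) ^ L)) ∧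
      Steps (2 * n + 6 + 2 * d) (m * (L + 2)) (insert c (Set.range t))
        (insert f (Set.range t)) := by
    intro c hc j m
    induction m with
    | zero => exact ⟨c, hc, fun x => by simp, by
        rw [zero_mul]; exact Steps.of_subset (subset_aff _)⟩
    | succ m ih =>
      obtain ⟨f, hf, hfe, hS⟩ := ih
      obtain ⟨h, hh, hhe, hS'⟩ := Steps.mul hn L hf (ht j)
      refine ⟨h, hh, fun x => ?_, ?_⟩
      · have e : h x - c x * t j x ^ (m + 1) =
            (h x - f x * t j x) + (f x - c x * t j x ^ m) * t j x := by ring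
        rw [e]
        refine (abs_add_le _ _).trans ?_
        rw [abs_mul]
        have h1 := mul_le_of_le_one_right (abs_nonneg (f x - c x * t j x ^ m)) (ht j x)
        have h2 := hhe x
        have h3 := hfe x
        push_cast
        linarith
      · rw [Nat.succ_mul m]
        refine hS.trans ?_
        have h4 := (hS'.mono_left (s' := insert f (Set.range t)) ?_).carry_range t
          fun i => mem_aff (Set.mem_insert_of_mem _ ⟨i, rfl⟩)
        · rw [Fintype.card_fin] at h4
          exact h4.mono_right (subset_aff _)
        · rintro _ (rfl | rfl)
          · exact mem_aff (by simp)
          · exact mem_aff (by simp)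
  induction J using Finset.induction_on with
  | empty =>
    exact ⟨c, hc, fun x => by simp, by
      rw [Finset.sum_empty, zero_mul]; exact Steps.of_subset (subset_aff _)⟩
  | insert j J hj ih =>
    obtain ⟨f, hf, hfe, hS⟩ := ih
    obtain ⟨h, hh, hhe, hS'⟩ := step f hf j (γ j)
    refine ⟨h, hh, fun x => ?_, ?_⟩
    · rw [Finset.prod_insert hj, Finset.sum_insert hj]
      have e : h x - c x * (t j x ^ γ j * ∏ j ∈ J, t j x ^ γ j) =
          (h x - f x * t j x ^ γ j) + (f x - c x * ∏ j ∈ J, t j x ^ γ j) * t j x ^ γ j := by ring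
      rw [e]
      refine (abs_add_le _ _).trans ?_
      rw [abs_mul, abs_pow]
      have h1 := mul_le_of_le_one_right (abs_nonneg (f x - c x * ∏ j ∈ J, t j x ^ γ j))
        (pow_le_one₀ (n := γ j) (abs_nonneg _) (ht j x))
      have h2 := hhe x
      have h3 := hfe x
      push_cast
      push_cast at h3
      linarith
    · rw [Finset.sum_insert hj, add_comm (γ j), add_mul]
      exact hS.trans hS'

end Products

section Terms

variable {X : Type*}

theorem exists_quantize_nonneg {N : ℕ} {q τ : ℝ} (hq : 1 ≤ q) (hτ : 0 < τ) (β : ℕ → ℝ)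
    (hβ : ∀ n, 0 ≤ β n) (hs : ∑ n ∈ Finset.range N, β n ^ q ≤ 1) :
    ((∑ n ∈ Finset.range N, ⌊β n / τ⌋₊ : ℕ) : ℝ) ≤ τ ^ (-q) := by
  have h : ∀ n ∈ Finset.range N, ((⌊β n / τ⌋₊ : ℕ) : ℝ) ≤ β n ^ q * τ ^ (-q) := fun n _ => by
    rw [Real.rpow_neg hτ.le, ← div_eq_mul_inv, ← Real.div_rpow (hβ n) hτ.le]
    have h0 : 0 ≤ β n / τ := div_nonneg (hβ n) hτ.le
    rcases lt_or_ge (β n / τ) 1 with h | h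
    · rw [Nat.floor_eq_zero.2 h, Nat.cast_zero]
      exact Real.rpow_nonneg h0 q
    · exact (Nat.floor_le h0).trans (Real.self_le_rpow_of_one_le h hq)
  rw [Nat.cast_sum]
  refine (Finset.sum_le_sum h).trans ?_
  rw [← Finset.sum_mul]
  exact mul_le_of_le_one_left (Real.rpow_nonneg hτ.le _) hs

theorem abs_sub_mul_floor_le {β τ : ℝ} (hτ : 0 < τ) :
    |τ * ((⌊max β 0 / τ⌋₊ : ℕ) - (⌊max (-β) 0 / τ⌋₊ : ℕ))| ≤ |β| ∧
    |β - τ * ((⌊max β 0 / τ⌋₊ : ℕ) - (⌊max (-β) 0 / τ⌋₊ : ℕ))| ≤ min τ |β| := by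
  have key : ∀ y : ℝ, 0 ≤ y → 0 ≤ τ * (⌊y / τ⌋₊ : ℕ) ∧ τ * (⌊y / τ⌋₊ : ℕ) ≤ y ∧
      y ≤ τ * (⌊y / τ⌋₊ : ℕ) + τ := fun y hy => by
    have h1 := Nat.floor_le (div_nonneg hy hτ.le)
    have h2 := (Nat.lt_floor_add_one (y / τ)).le
    rw [le_div_iff₀ hτ] at h1
    rw [div_le_iff₀ hτ] at h2
    exact ⟨by positivity, by linarith, by linarith⟩
  rcases le_total β 0 with h | h
  · obtain ⟨h1, h2, h3⟩ := key (-β) (by linarith)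
    rw [max_eq_right h, max_eq_left (by linarith : 0 ≤ -β), zero_div, Nat.floor_zero, Nat.cast_zero,
      zero_sub, abs_of_nonpos h]
    refine ⟨abs_le.2 ⟨by linarith, by linarith⟩, le_min (abs_le.2 ⟨?_, ?_⟩) (abs_le.2 ⟨?_, ?_⟩)⟩ <;>
      linarith
  · obtain ⟨h1, h2, h3⟩ := key β h
    rw [max_eq_left h, max_eq_right (by linarith : -β ≤ 0), zero_div, Nat.floor_zero, Nat.cast_zero,
      sub_zero, abs_of_nonneg h]
    refine ⟨abs_le.2 ⟨by linarith, by linarith⟩, le_min (abs_le.2 ⟨?_, ?_⟩) (abs_le.2 ⟨?_, ?_⟩)⟩ <;>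
      linarith

/-- Approximation of the product of a tabulated function and a monomial. -/
theorem Steps.term {d N M S T K Q w n k : ℕ} {q τ : ℝ} (hq : 1 ≤ q) (hτ : 0 < τ)
    (hS : 0 < S) (hT : 0 < T) (hK : 0 < K) (hw0 : 0 < w) (hn : 0 < n)
    (hKQ : K < Q ^ T) (hM : τ ^ (-q) ≤ M) (hN : N ≤ K * M) (hw : M ≤ w ^ 2 * S ^ 2 * T)
    (ν : X → ℕ) (hν : ∀ x, ν x < N) (L : ℕ) (t : Fin d → X → ℝ) (ht : ∀ j x, |t j x| ≤ 1)
    (α : ℕ → ℝ) (hα : ∑ n ∈ Finset.range N, |α n| ^ q ≤ 1) (γ : Fin d → ℕ) (hγ : ∑ j, γ j ≤ k) :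
    ∃ f : X → ℝ, (∀ x, |α (ν x) * ∏ j, t j x ^ γ j - f x| ≤
        min τ |α (ν x)| + k * (2 / (n ^ 2) ^ L)) ∧
      Steps (48 * w + 4 * Q + 2 * n + 46 + 2 * d)
        (5 * S * T + 2 + 2 * S * (T + 2) + k * (L + 2))
        (insert (fun x => (ν x : ℝ)) (Set.range t)) {f} := by
  have hsum : ∀ s : ℝ, s = 1 ∨ s = -1 →
      ∑ n ∈ Finset.range N, ⌊max (s * α n) 0 / τ⌋₊ ≤ M := fun s hs => by
    have h1 := exists_quantize_nonneg (N := N) hq hτ (fun n => max (s * α n) 0)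
      (fun n => le_max_right _ _) ((Finset.sum_le_sum fun n _ =>
        Real.rpow_le_rpow (le_max_right _ _) (max_le ?_ (abs_nonneg _)) (by linarith)).trans hα)
    · exact_mod_cast h1.trans hM
    · rcases hs with rfl | rfl
      · simpa using le_abs_self _
      · simpa using neg_le_abs _
  have s1 := Steps.sparse hS hT hK hw0 hKQ ν hν _ (hsum 1 (Or.inl rfl)) hN hw
  have s2 := Steps.sparse hS hT hK hw0 hKQ ν hν _ (hsum (-1) (Or.inr rfl)) hN hw
  simp only [one_mul, neg_mul] at s1 s2
  set c : X → ℝ := fun x =>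
    τ * ((⌊max (α (ν x)) 0 / τ⌋₊ : ℕ) - (⌊max (-α (ν x)) 0 / τ⌋₊ : ℕ)) with hc
  have hα1 : ∀ x, |α (ν x)| ≤ 1 := fun x => by
    have h1 : |α (ν x)| ^ q ≤ 1 := (Finset.single_le_sum (f := fun n => |α n| ^ q)
      (fun n _ => Real.rpow_nonneg (abs_nonneg _) q) (Finset.mem_range.2 (hν x))).trans hα
    by_contra! h
    exact absurd (Real.one_lt_rpow h (by linarith)) (not_lt.2 h1)
  obtain ⟨f, -, hfe, hf⟩ := Steps.mul_prod hn L t ht γ Finset.univ (c := c)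
    fun x => (abs_sub_mul_floor_le hτ).1.trans (hα1 x)
  refine ⟨f, fun x => ?_, ?_⟩
  · have e : α (ν x) * ∏ j, t j x ^ γ j - f x =
        (α (ν x) - c x) * (∏ j, t j x ^ γ j) - (f x - c x * ∏ j, t j x ^ γ j) := by ring
    rw [e]
    refine (abs_sub _ _).trans (add_le_add ?_ ((hfe x).trans ?_))
    · rw [abs_mul]
      refine (mul_le_of_le_one_right (abs_nonneg _) ?_).trans (abs_sub_mul_floor_le hτ).2
      rw [Finset.abs_prod]
      refine Finset.prod_le_one (fun _ _ => abs_nonneg _) fun j _ => ?_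
      rw [abs_pow]
      exact pow_le_one₀ (abs_nonneg _) (ht j x)
    · gcongr
  · have s3 := ((s1.par s2).mono_left (s' := insert (fun x => (ν x : ℝ)) (Set.range t))
      (Set.singleton_subset_iff.2 (mem_aff (by simp)))).carry_range t
      fun j => mem_aff (by simp)
    rw [Fintype.card_fin] at s3
    have s4 := (hf.mono_width (w' := 48 * w + 4 * Q + 2 * n + 46 + 2 * d) (by omega)).mono_right
      (t' := {f}) (Set.singleton_subset_iff.2 (mem_aff (by simp)))
    refine ((s3.mono_width (by omega)).trans (s4.mono_left ?_)).pad ?_ (by omega)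
    · rintro _ (rfl | ⟨j, rfl⟩)
      · exact mul_mem_aff _ (sub_mem_aff (mem_aff (by simp)) (mem_aff (by simp)))
      · exact mem_aff (by simp)
    · gcongr

end Terms

section Cells

variable {d b ℓ : ℕ} {ε : ℝ}

theorem trimmedCell_subset_baseCell (hb : 0 < b) (hε : 0 < ε) (i : Fin d → Fin (b ^ ℓ)) :
    trimmedCell d b ℓ ε (fun j => i j) ⊆ baseCell d b ℓ fun j => i j := by
  intro x hx j
  have hxj := hx j
  have hB : (0 : ℝ) < (b : ℝ) ^ ℓ := by positivity
  split_ifs at hxj with h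
  · exact ⟨hxj.1, by linarith [hxj.2]⟩
  · have hi : (i j : ℕ) + 1 = b ^ ℓ := by have := (i j).2; dsimp only at h; omega
    have hi' : ((i j : ℕ) : ℝ) + 1 = (b : ℝ) ^ ℓ := by exact_mod_cast hi
    refine ⟨?_, ?_⟩
    · refine le_trans (le_of_eq ?_) hxj.1
      rw [eq_sub_of_add_eq hi']
      field_simp
    · rw [hi', div_self hB.ne']
      exact hxj.2

theorem eq_of_mem_baseCell (hb : 0 < b) {i i' : Fin d → Fin (b ^ ℓ)} {x : Fin d → ℝ}
    (h : x ∈ baseCell d b ℓ fun j => i j) (h' : x ∈ baseCell d b ℓ fun j => i' j) : i = i' := by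
  have hB : (0 : ℝ) < (b : ℝ) ^ ℓ := by positivity
  ext j
  have h1 := (h j).1.trans_lt (h' j).2
  have h2 := (h' j).1.trans_lt (h j).2
  rw [div_lt_div_iff_of_pos_right hB] at h1 h2
  have h3 : (i j : ℕ) < i' j + 1 := by exact_mod_cast h1
  have h4 : (i' j : ℕ) < i j + 1 := by exact_mod_cast h2
  omega

theorem ppoly_eq (hb : 0 < b) {k : ℕ} (a : (Fin d → Fin (b ^ ℓ)) → (Fin d → Fin (k + 1)) → ℝ)
    {i : Fin d → Fin (b ^ ℓ)} {x : Fin d → ℝ} (h : x ∈ baseCell d b ℓ fun j => i j) :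
    ppoly d b ℓ k a x =
      ∑ γ ∈ Γset d k, a i γ * ∏ j, ((b : ℝ) ^ ℓ * x j - (i j : ℕ)) ^ (γ j : ℕ) := by
  rw [ppoly, Finset.sum_eq_single i]
  · simp only [rho, if_pos h]
  · intro i' _ hi'
    refine Finset.sum_eq_zero fun γ _ => ?_
    rw [rho, if_neg fun h' => hi' (eq_of_mem_baseCell hb h' h), mul_zero]
  · exact fun h => absurd (Finset.mem_univ _) h

theorem exists_mem_trimmedCell {x : Fin d → ℝ} (hx : x ∈ goodRegion d b ℓ ε) :
    ∃ i : Fin d → Fin (b ^ ℓ), x ∈ trimmedCell d b ℓ ε fun j => i j := by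
  obtain ⟨i, hi, hx⟩ := Set.mem_iUnion₂.1 hx
  exact ⟨fun j => ⟨i j, hi j⟩, hx⟩

theorem trimmedCell_bounds (hb : 0 < b) (hε : 0 < ε) {i : Fin d → Fin (b ^ ℓ)} {x : Fin d → ℝ}
    (h : x ∈ trimmedCell d b ℓ ε fun j => i j) (j : Fin d) :
    ((i j : ℕ) : ℝ) ≤ (b : ℝ) ^ ℓ * (x j - relu (x j - (1 - ((b : ℝ) ^ ℓ)⁻¹ / 2))) ∧
      (b : ℝ) ^ ℓ * (x j - relu (x j - (1 - ((b : ℝ) ^ ℓ)⁻¹ / 2))) ≤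
        (i j : ℕ) + 1 - min ((b : ℝ) ^ ℓ * ε) (1 / 2) := by
  have hB : (0 : ℝ) < (b : ℝ) ^ ℓ := by positivity
  have hmin : x j - relu (x j - (1 - ((b : ℝ) ^ ℓ)⁻¹ / 2)) =
      min (x j) (1 - ((b : ℝ) ^ ℓ)⁻¹ / 2) := by
    unfold relu
    rcases le_total (x j) (1 - ((b : ℝ) ^ ℓ)⁻¹ / 2) with h | h
    · rw [max_eq_right (by linarith), min_eq_left h, sub_zero]
    · rw [max_eq_left (by linarith), min_eq_right h]; ring
  have hc : (b : ℝ) ^ ℓ * (1 - ((b : ℝ) ^ ℓ)⁻¹ / 2) = (b : ℝ) ^ ℓ - 1 / 2 := by field_simp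
  rw [hmin, mul_min_of_nonneg _ _ hB.le, hc]
  have h1 := trimmedCell_subset_baseCell hb hε i h j
  rw [div_le_iff₀ hB] at h1
  have hi : ((i j : ℕ) : ℝ) + 1 ≤ (b : ℝ) ^ ℓ := by exact_mod_cast (i j).2
  refine ⟨le_min (by linarith [h1.1]) (by linarith), ?_⟩
  have hxj := h j
  split_ifs at hxj with h2
  · have h3 : x j + ε < (((i j : ℕ) : ℝ) + 1) / (b : ℝ) ^ ℓ := by linarith [hxj.2]
    rw [lt_div_iff₀ hB] at h3
    have h4 := min_le_left ((b : ℝ) ^ ℓ * ε) (1 / 2)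
    have h5 := min_le_left ((b : ℝ) ^ ℓ * x j) ((b : ℝ) ^ ℓ - 1 / 2)
    linarith
  · have hi2 : (i j : ℕ) + 1 = b ^ ℓ := by have := (i j).2; dsimp only at h2; omega
    have hi' : ((i j : ℕ) : ℝ) + 1 = (b : ℝ) ^ ℓ := by exact_mod_cast hi2
    have h4 := min_le_right ((b : ℝ) ^ ℓ * ε) (1 / 2)
    have h5 := min_le_right ((b : ℝ) ^ ℓ * x j) ((b : ℝ) ^ ℓ - 1 / 2)
    linarith

/-- A network computing the index of the cell containing a point and the coordinates relative to
this cell. -/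
theorem Steps.cell (hb : 0 < b) (hε : 0 < ε) {X : Type*} {u : Fin d → X → ℝ}
    {i : X → Fin d → Fin (b ^ ℓ)}
    (hi : ∀ x, (fun j => u j x) ∈ trimmedCell d b ℓ ε fun j => i x j) {Q L : ℕ} (hQ0 : 0 < Q)
    (hQ : b ^ ℓ ≤ Q ^ L) :
    Steps (d * (2 * Q + 2) + 4 * d) (1 + L) (Set.range u)
      (insert (fun x => ((finFunctionFinEquiv (i x) : ℕ) : ℝ))
        (Set.range fun j x => (b : ℝ) ^ ℓ * u j x - (i x j : ℕ))) := by
  set c : ℝ := 1 - ((b : ℝ) ^ ℓ)⁻¹ / 2 with hc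
  set v : Fin d → X → ℝ := fun j x => (b : ℝ) ^ ℓ * (u j x - relu (u j x - c)) with hv
  have hB : (0 : ℝ) < (b : ℝ) ^ ℓ := by positivity
  have s1 := (Steps.layer (w := d) (s := Set.range u) (fun (j : Fin d) x => u j x - c)
    (fun j => sub_mem_aff (mem_aff ⟨j, rfl⟩) (const_mem_aff _ _)) (by simp)).carry_range u
    fun j => mem_aff ⟨j, rfl⟩
  have s2 : ∀ j ∈ (Finset.univ : Finset (Fin d)), Steps (2 * Q + 2) L (Set.range (Sum.elim u v))
      {fun x => v j x - (i x j : ℕ)} := fun j _ => by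
    have h := Steps.mod (η := min ((b : ℝ) ^ ℓ * ε) (1 / 2)) (by positivity) zero_lt_one hQ0 L
      (v := v j) (m := fun x => i x j) (fun x => (trimmedCell_bounds hb hε (hi x) j).1)
      (fun x => (trimmedCell_bounds hb hε (hi x) j).2)
      fun x => by rw [mul_one]; exact (i x j).2.trans_le hQ
    simp only [Nat.mod_one, Nat.cast_zero, add_zero] at h
    exact h.mono_left (Set.singleton_subset_iff.2 (mem_aff ⟨Sum.inr j, rfl⟩))
  have s3 := (Steps.par_finset Finset.univ s2).carry_range (Sum.elim u v)
    fun j => mem_aff ⟨j, rfl⟩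
  rw [Finset.card_univ, Fintype.card_sum, Fintype.card_fin] at s3
  refine ((s1.mono_width ?_).trans ((s3.mono_width (by omega)).mono_left ?_)).mono_right ?_
  · rw [Fintype.card_fin]
    nlinarith [Nat.zero_le (d * Q)]
  · rintro _ ⟨j | j, rfl⟩
    · exact mem_aff (Or.inr ⟨j, rfl⟩)
    · exact mul_mem_aff _ (sub_mem_aff (mem_aff (Or.inr ⟨j, rfl⟩)) (mem_aff (Or.inl ⟨j, rfl⟩)))
  · set s := (⋃ j ∈ (Finset.univ : Finset (Fin d)), {fun x => v j x - ((i x j : ℕ) : ℝ)}) ∪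
      Set.range (Sum.elim u v) with hs
    have hij : ∀ j, (fun x => ((i x j : ℕ) : ℝ)) ∈ aff s := fun j => by
      have h1 : v j ∈ aff s := mem_aff (Or.inr ⟨Sum.inr j, rfl⟩)
      have h2 : (fun x => v j x - ((i x j : ℕ) : ℝ)) ∈ aff s :=
        mem_aff (Or.inl (Set.mem_biUnion (Finset.mem_univ j) rfl))
      have := sub_mem_aff h1 h2
      simpa using this
    rintro _ (rfl | ⟨j, rfl⟩)
    · have h := sum_mem_aff (Finset.univ : Finset (Fin d)) fun j _ =>
        mul_mem_aff (((b ^ ℓ) ^ (j : ℕ) : ℕ) : ℝ) (hij j)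
      have e : (fun x => ((finFunctionFinEquiv (i x) : ℕ) : ℝ)) =
          fun x => ∑ j : Fin d, (((b ^ ℓ) ^ (j : ℕ) : ℕ) : ℝ) * ((i x j : ℕ) : ℝ) := by
        ext x
        rw [finFunctionFinEquiv_apply]
        push_cast
        exact Finset.sum_congr rfl fun j _ => mul_comm _ _
      rw [e]
      exact h
    · exact sub_mem_aff (mul_mem_aff _ (mem_aff (Or.inr ⟨Sum.inl j, rfl⟩))) (hij j)

/-- Pointwise approximation of piecewise polynomials on the good region. -/
theorem exists_network {k M S T K Q w n Q₂ L : ℕ} {q τ A : ℝ} (hb : 0 < b) (hε : 0 < ε)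
    (hq : 1 ≤ q) (hτ : 0 < τ) (hA : 0 ≤ A)
    (hS : 0 < S) (hT : 0 < T) (hK : 0 < K) (hw0 : 0 < w) (hn : 0 < n)
    (hKQ : K < Q ^ T) (hM : τ ^ (-q) ≤ M) (hN : (b ^ ℓ) ^ d ≤ K * M)
    (hw : M ≤ w ^ 2 * S ^ 2 * T) (hQ0 : 0 < Q₂) (hQ₂ : b ^ ℓ ≤ Q₂ ^ L)
    (a α : (Fin d → Fin (b ^ ℓ)) → (Fin d → Fin (k + 1)) → ℝ)
    (hα : ∀ γ ∈ Γset d k, ∑ i, |α i γ| ^ q ≤ 1) (haα : ∀ γ ∈ Γset d k, ∀ i, a i γ = A * α i γ) :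
    ∃ g ∈ NN d 1 ((d * (2 * Q₂ + 2) + 4 * d) +
        (Γset d k).card * (48 * w + 4 * Q + 2 * n + 46 + 2 * d) + 1)
        (1 + L + (5 * S * T + 2 + 2 * S * (T + 2) + k * (L + 2))),
      ∀ x ∈ goodRegion d b ℓ ε, ∃ i : Fin d → Fin (b ^ ℓ), x ∈ baseCell d b ℓ (fun j => i j) ∧
        |ppoly d b ℓ k a x - g x 0| ≤
          ∑ γ ∈ Γset d k, (min (A * τ) |a i γ| + A * (k * (2 / (n ^ 2) ^ L))) := by
  have hB : (0 : ℝ) < (b : ℝ) ^ ℓ := by positivity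
  choose i hi using fun x : goodRegion d b ℓ ε => exists_mem_trimmedCell x.2
  have hbase := fun x => trimmedCell_subset_baseCell hb hε (i x) (hi x)
  have s1 := Steps.cell hb hε (u := fun j (x : goodRegion d b ℓ ε) => x.1 j) hi hQ0 hQ₂
  set t : Fin d → goodRegion d b ℓ ε → ℝ := fun j x => (b : ℝ) ^ ℓ * x.1 j - (i x j : ℕ) with ht
  have ht1 : ∀ j x, |t j x| ≤ 1 := fun j x => by
    have h := hbase x j
    rw [div_le_iff₀ hB, lt_div_iff₀ hB] at h
    exact abs_le.2 ⟨by simp only [ht]; linarith [h.1], by simp only [ht]; linarith [h.2]⟩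
  have key : ∀ γ : Γset d k, ∃ f : goodRegion d b ℓ ε → ℝ,
      (∀ x, |α (i x) γ * ∏ j, t j x ^ (γ.1 j : ℕ) - f x| ≤
        min τ |α (i x) γ| + k * (2 / (n ^ 2) ^ L)) ∧
      Steps (48 * w + 4 * Q + 2 * n + 46 + 2 * d)
        (5 * S * T + 2 + 2 * S * (T + 2) + k * (L + 2))
        (insert (fun x => ((finFunctionFinEquiv (i x) : ℕ) : ℝ)) (Set.range t)) {f} := by
    intro γ
    set β : ℕ → ℝ := fun m => if h : m < (b ^ ℓ) ^ d then
      α (finFunctionFinEquiv.symm ⟨m, h⟩) γ else 0 with hβ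
    have hβi : ∀ i, β (finFunctionFinEquiv i : ℕ) = α i γ := fun i => by
      rw [hβ]
      dsimp only
      rw [dif_pos (finFunctionFinEquiv i).2, Fin.eta, Equiv.symm_apply_apply]
    obtain ⟨f, hf, hS⟩ := Steps.term hq hτ hS hT hK hw0 hn hKQ hM hN hw
      (fun x => (finFunctionFinEquiv (i x) : ℕ)) (fun x => (finFunctionFinEquiv (i x)).2) L t ht1 β
      (by
        rw [Finset.sum_range, ← Equiv.sum_comp finFunctionFinEquiv]
        simp only [hβi]
        exact hα γ γ.2) (fun j => (γ.1 j : ℕ)) (k := k) (by simpa [Γset] using γ.2)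
    simp only [hβi] at hf
    exact ⟨f, hf, hS⟩
  choose f hf hfS using key
  have s2 := s1.mono_width (w' := (d * (2 * Q₂ + 2) + 4 * d) +
    (Γset d k).card * (48 * w + 4 * Q + 2 * n + 46 + 2 * d) + 1) (by omega)
  have s3 := Steps.par_finset Finset.univ fun γ _ => hfS γ
  rw [Finset.card_univ, Fintype.card_coe] at s3
  obtain ⟨g, hg, hgf⟩ := Steps.exists_mem_NNaux (by omega) ((s2.trans
    (s3.mono_width (by omega))).mono_right (t' := {fun x => A * ∑ γ : Γset d k, f γ x})
    (Set.singleton_subset_iff.2 (mul_mem_aff _ (sum_mem_aff _ fun γ _ => mem_aff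
      (Set.mem_biUnion (Finset.mem_univ γ) rfl)))))
  refine ⟨g, hg, fun x hx => ⟨i ⟨x, hx⟩, hbase ⟨x, hx⟩, ?_⟩⟩
  rw [ppoly_eq hb a (hbase ⟨x, hx⟩), ← hgf ⟨x, hx⟩, ← Finset.sum_coe_sort (Γset d k),
    ← Finset.sum_coe_sort (Γset d k), Finset.mul_sum, ← Finset.sum_sub_distrib]
  refine (Finset.abs_sum_le_sum_abs _ _).trans (Finset.sum_le_sum fun γ _ => ?_)
  have h := mul_le_mul_of_nonneg_left (hf γ ⟨x, hx⟩) hA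
  rw [haα γ γ.2, abs_mul, abs_of_nonneg hA, ← mul_min_of_nonneg _ _ hA, ← mul_add]
  refine le_trans (le_of_eq ?_) h
  rw [mul_assoc, ← mul_sub, abs_mul, abs_of_nonneg hA]

end Cells

section LpBounds

variable {d b ℓ : ℕ} {ε : ℝ}

theorem measurableSet_baseCell (i : Fin d → ℕ) : MeasurableSet (baseCell d b ℓ i) := by
  simp only [baseCell, Set.ofPred_forall]
  exact MeasurableSet.iInter fun j => (measurableSet_le measurable_const (measurable_pi_apply j)).inter
    (measurableSet_lt (measurable_pi_apply j) measurable_const)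

theorem measurableSet_goodRegion : MeasurableSet (goodRegion d b ℓ ε) := by
  refine MeasurableSet.biUnion (Set.to_countable _) fun i _ => ?_
  simp only [trimmedCell, Set.ofPred_forall]
  refine MeasurableSet.iInter fun j => ?_
  split_ifs
  · exact (measurableSet_le measurable_const (measurable_pi_apply j)).inter
      (measurableSet_lt (measurable_pi_apply j) measurable_const)
  · exact (measurableSet_le measurable_const (measurable_pi_apply j)).inter
      (measurableSet_lt (measurable_pi_apply j) measurable_const)

theorem volume_baseCell (i : Fin d → ℕ) :
    volume (baseCell d b ℓ i) = ENNReal.ofReal ((((b : ℝ) ^ ℓ) ^ d)⁻¹) := by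
  have e : baseCell d b ℓ i = Set.pi Set.univ fun j =>
      Set.Ico ((i j : ℝ) / (b : ℝ) ^ ℓ) (((i j : ℝ) + 1) / (b : ℝ) ^ ℓ) := by
    ext x
    simp [baseCell]
  have h : ∀ j, ((i j : ℝ) + 1) / (b : ℝ) ^ ℓ - (i j : ℝ) / (b : ℝ) ^ ℓ = ((b : ℝ) ^ ℓ)⁻¹ :=
    fun j => by ring
  rw [e, Real.volume_pi_Ico]
  simp only [h]
  rw [Finset.prod_const, Finset.card_univ, Fintype.card_fin, ← ENNReal.ofReal_pow (by positivity),
    inv_pow]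

/-- The function equal to `β i` on the cell with index `i`. -/
def stepFun (d b ℓ : ℕ) (β : (Fin d → Fin (b ^ ℓ)) → ℝ) (x : Fin d → ℝ) : ℝ :=
  ∑ i : Fin d → Fin (b ^ ℓ), (baseCell d b ℓ fun j => i j).indicator (fun _ => β i) x

theorem stepFun_eq (hb : 0 < b) (β : (Fin d → Fin (b ^ ℓ)) → ℝ) {i : Fin d → Fin (b ^ ℓ)}
    {x : Fin d → ℝ} (h : x ∈ baseCell d b ℓ fun j => i j) : stepFun d b ℓ β x = β i := by
  rw [stepFun, Finset.sum_eq_single i]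
  · rw [Set.indicator_of_mem h]
  · exact fun i' _ hi' => Set.indicator_of_notMem
      (fun h' => hi' (eq_of_mem_baseCell hb h' h)) _
  · exact fun h => absurd (Finset.mem_univ _) h

theorem stepFun_eq_zero (β : (Fin d → Fin (b ^ ℓ)) → ℝ) {x : Fin d → ℝ}
    (h : ∀ i : Fin d → Fin (b ^ ℓ), x ∉ baseCell d b ℓ fun j => i j) : stepFun d b ℓ β x = 0 :=
  Finset.sum_eq_zero fun i _ => Set.indicator_of_notMem (h i) _

theorem measurable_stepFun (β : (Fin d → Fin (b ^ ℓ)) → ℝ) : Measurable (stepFun d b ℓ β) :=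
  Finset.measurable_fun_sum _ fun _ _ => measurable_const.indicator (measurableSet_baseCell _)

theorem eLpNorm_stepFun_le (hb : 0 < b) {β : (Fin d → Fin (b ^ ℓ)) → ℝ} (hβ : ∀ i, 0 ≤ β i)
    {D : ℝ} (hD : 0 ≤ D) {p : ℝ≥0∞} (hp : p ≠ 0) (htop : p = ∞ → ∀ i, β i ≤ D)
    (hfin : p ≠ ∞ → ∑ i, β i ^ p.toReal ≤ ((b : ℝ) ^ ℓ) ^ d * D ^ p.toReal) :
    eLpNorm (stepFun d b ℓ β) p volume ≤ ENNReal.ofReal D := by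
  by_cases hpt : p = ∞
  · rw [hpt, eLpNorm_exponent_top]
    refine eLpNormEssSup_le_of_ae_bound (Filter.Eventually.of_forall fun x => ?_)
    by_cases h : ∃ i : Fin d → Fin (b ^ ℓ), x ∈ baseCell d b ℓ fun j => i j
    · obtain ⟨i, hi⟩ := h
      rw [stepFun_eq hb β hi, Real.norm_eq_abs, abs_of_nonneg (hβ i)]
      exact htop hpt i
    · rw [stepFun_eq_zero β (not_exists.1 h), norm_zero]
      exact hD
  · have hp0 : 0 < p.toReal := ENNReal.toReal_pos hp hpt
    have hB : (0 : ℝ) < ((b : ℝ) ^ ℓ) ^ d := by positivity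
    have e : ∀ x, ‖stepFun d b ℓ β x‖ₑ ^ p.toReal = ∑ i : Fin d → Fin (b ^ ℓ),
        (baseCell d b ℓ fun j => i j).indicator (fun _ => ENNReal.ofReal (β i ^ p.toReal)) x := by
      intro x
      by_cases h : ∃ i : Fin d → Fin (b ^ ℓ), x ∈ baseCell d b ℓ fun j => i j
      · obtain ⟨i, hi⟩ := h
        rw [stepFun_eq hb β hi, Finset.sum_eq_single i, Set.indicator_of_mem hi,
          Real.enorm_eq_ofReal (hβ i), ENNReal.ofReal_rpow_of_nonneg (hβ i) hp0.le]
        · exact fun i' _ hi' => Set.indicator_of_notMem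
            (fun h' => hi' (eq_of_mem_baseCell hb h' hi)) _
        · exact fun h => absurd (Finset.mem_univ _) h
      · rw [stepFun_eq_zero β (not_exists.1 h), enorm_zero, ENNReal.zero_rpow_of_pos hp0]
        exact (Finset.sum_eq_zero fun i _ =>
          Set.indicator_of_notMem (not_exists.1 h i) _).symm
    rw [eLpNorm_eq_lintegral_rpow_enorm_toReal hp hpt]
    simp only [e]
    rw [lintegral_finsetSum _ fun i _ => measurable_const.indicator (measurableSet_baseCell _)]
    simp only [lintegral_indicator_const (measurableSet_baseCell _), volume_baseCell]
    rw [← Finset.sum_mul, ← ENNReal.ofReal_sum_of_nonneg fun i _ => Real.rpow_nonneg (hβ i) _,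
      ← ENNReal.ofReal_mul (Finset.sum_nonneg fun i _ => Real.rpow_nonneg (hβ i) _),
      one_div, ENNReal.rpow_inv_le_iff hp0, ENNReal.ofReal_rpow_of_nonneg hD hp0.le]
    refine ENNReal.ofReal_le_ofReal ?_
    rw [← div_eq_mul_inv, div_le_iff₀ hB, mul_comm]
    exact hfin hpt

theorem eLpNorm_le_of_stepFun {k : ℕ} (hb : 0 < b) {p : ℝ≥0∞} (hp : 1 ≤ p)
    {f : (Fin d → ℝ) → ℝ} {I : Finset (Fin d → Fin (k + 1))}
    {e : (Fin d → Fin (k + 1)) → (Fin d → Fin (b ^ ℓ)) → ℝ} {κ D : ℝ} (he : ∀ γ i, 0 ≤ e γ i)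
    (hκ : 0 ≤ κ) (hD : 0 ≤ D) (htop : p = ∞ → ∀ γ ∈ I, ∀ i, e γ i ≤ D)
    (hfin : p ≠ ∞ → ∀ γ ∈ I, ∑ i, e γ i ^ p.toReal ≤ ((b : ℝ) ^ ℓ) ^ d * D ^ p.toReal)
    (hf : ∀ x ∈ goodRegion d b ℓ ε, ∃ i : Fin d → Fin (b ^ ℓ),
      x ∈ baseCell d b ℓ (fun j => i j) ∧ |f x| ≤ ∑ γ ∈ I, (e γ i + κ)) :
    eLpNorm f p (volume.restrict (goodRegion d b ℓ ε)) ≤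
      ENNReal.ofReal (I.card * (D + κ)) := by
  have hp0 : p ≠ 0 := (zero_lt_one.trans_le hp).ne'
  have h1 : eLpNorm f p (volume.restrict (goodRegion d b ℓ ε)) ≤
      eLpNorm (∑ γ ∈ I, (stepFun d b ℓ (e γ) + stepFun d b ℓ fun _ => κ)) p
        (volume.restrict (goodRegion d b ℓ ε)) := by
    refine eLpNorm_mono_ae (ae_restrict_of_forall_mem measurableSet_goodRegion fun x hx => ?_)
    obtain ⟨i, hi, h⟩ := hf x hx
    rw [Real.norm_eq_abs, Real.norm_eq_abs]
    refine h.trans (le_trans (le_of_eq ?_) (le_abs_self _))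
    simp only [Finset.sum_apply, Pi.add_apply, stepFun_eq hb _ hi]
  refine h1.trans ((eLpNorm_mono_measure _ Measure.restrict_le_self).trans ?_)
  refine (eLpNorm_sum_le (fun γ _ => ((measurable_stepFun _).add
    (measurable_stepFun _)).aestronglyMeasurable) hp).trans ?_
  have h2 : ∀ γ ∈ I, eLpNorm (stepFun d b ℓ (e γ) + stepFun d b ℓ fun _ => κ) p volume ≤
      ENNReal.ofReal (D + κ) := fun γ hγ => by
    refine (eLpNorm_add_le (measurable_stepFun _).aestronglyMeasurable
      (measurable_stepFun _).aestronglyMeasurable hp).trans ?_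
    rw [ENNReal.ofReal_add hD hκ]
    refine add_le_add (eLpNorm_stepFun_le hb (he γ) hD hp0 (fun h => htop h γ hγ)
      fun h => hfin h γ hγ) (eLpNorm_stepFun_le hb (fun _ => hκ) hκ hp0 (fun _ _ => le_rfl)
        fun _ => ?_)
    rw [Finset.sum_const, Finset.card_univ, Fintype.card_fun, Fintype.card_fin, Fintype.card_fin,
      nsmul_eq_mul]
    push_cast
    exact le_rfl
  refine (Finset.sum_le_sum h2).trans (le_of_eq ?_)
  rw [Finset.sum_const, nsmul_eq_mul, ENNReal.ofReal_mul (Nat.cast_nonneg _),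
    ENNReal.ofReal_natCast]

theorem sum_min_rpow_le {ι : Type*} [Fintype ι] {A q r y : ℝ} (hA : 0 ≤ A) (hq : 0 ≤ q)
    (hqr : q ≤ r) (hy : 0 ≤ y) {a : ι → ℝ} (ha : ∑ i, |a i| ^ q ≤ A ^ q) :
    ∑ i, min (A * y) |a i| ^ r ≤ A ^ r * y ^ (r - q) := by
  have h : ∀ i, min (A * y) |a i| ^ r ≤ (A * y) ^ (r - q) * |a i| ^ q := fun i => by
    have h0 : 0 ≤ min (A * y) |a i| := le_min (mul_nonneg hA hy) (abs_nonneg _)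
    calc min (A * y) |a i| ^ r = min (A * y) |a i| ^ (r - q) * min (A * y) |a i| ^ q := by
          rw [← Real.rpow_add_of_nonneg h0 (sub_nonneg.2 hqr) hq, sub_add_cancel]
      _ ≤ _ := mul_le_mul (Real.rpow_le_rpow h0 (min_le_left _ _) (sub_nonneg.2 hqr))
          (Real.rpow_le_rpow h0 (min_le_right _ _) hq) (Real.rpow_nonneg h0 _)
          (Real.rpow_nonneg (mul_nonneg hA hy) _)
  refine (Finset.sum_le_sum fun i _ => h i).trans ?_
  rw [← Finset.mul_sum]
  refine (mul_le_mul_of_nonneg_left ha (Real.rpow_nonneg (mul_nonneg hA hy) _)).trans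
    (le_of_eq ?_)
  rw [Real.mul_rpow hA hy, mul_right_comm, ← Real.rpow_add_of_nonneg hA (sub_nonneg.2 hqr) hq,
    sub_add_cancel]

end LpBounds

section Parameters

theorem depth_le {S T L k : ℕ} (hS : 1 ≤ S) (hT : 1 ≤ T) (hL : 1 ≤ L) :
    1 + L + (5 * S * T + 2 + 2 * S * (T + 2) + k * (L + 2)) ≤ (14 + 3 * k) * (S * T + L) := by
  have h1 : S ≤ S * T := Nat.le_mul_of_pos_right S hT
  have h2 : k ≤ k * L := Nat.le_mul_of_pos_right k hL
  have h3 : 0 ≤ k * (S * T) := Nat.zero_le _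
  nlinarith

theorem width_le {d G w Q Q₂ n : ℕ} {V : ℝ} (hV : 1 ≤ V) (hw : (w : ℝ) ≤ 2 * V + 1)
    (hQ : (Q : ℝ) ≤ 3 * (V + 1)) (hQ₂ : (Q₂ : ℝ) ≤ V + 1) (hn : (n : ℝ) ≤ V) :
    (((d * (2 * Q₂ + 2) + 4 * d) + G * (48 * w + 4 * Q + 2 * n + 46 + 2 * d) + 1 : ℕ) : ℝ) ≤
      (10 * d + G * (216 + 2 * d) + 1) * V := by
  have hd : (0 : ℝ) ≤ d := Nat.cast_nonneg d
  have hdV : (d : ℝ) ≤ d * V := le_mul_of_one_le_right hd hV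
  have h1 : (d : ℝ) * (2 * Q₂ + 2) ≤ d * (6 * V) := mul_le_mul_of_nonneg_left (by linarith) hd
  have h2 : (G : ℝ) * (48 * w + 4 * Q + 2 * n + 46 + 2 * d) ≤ G * ((216 + 2 * d) * V) :=
    mul_le_mul_of_nonneg_left (by linarith) (Nat.cast_nonneg G)
  push_cast
  linarith

end Parameters

theorem pp_approx_sparse (d b k : ℕ) (hd : 1 ≤ d) (hb : 2 ≤ b)
    (p : ℝ≥0∞) (q : ℝ) (hq : 1 ≤ q) (hqp : ENNReal.ofReal q ≤ p) :
    ∃ C : ℝ, 0 < C ∧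
      ∀ (ℓ : ℕ) (ε δ : ℝ), 0 < ε → ε < (b : ℝ) ^ (-(ℓ : ℤ)) → 0 < δ →
        δ * q ≤ (d : ℝ) * ℓ →
      ∀ a : (Fin d → Fin (b ^ ℓ)) → (Fin d → Fin (k + 1)) → ℝ,
      ∀ S T W₀ L₀ : ℕ, 1 ≤ S → 1 ≤ T → 1 ≤ W₀ → 1 ≤ L₀ →
      ∃ W L : ℕ, 1 ≤ W ∧ 1 ≤ L ∧
        (W : ℝ) ≤ C * max
            (max ((b : ℝ) ^ (δ * q / 2) / ((S : ℝ) * Real.sqrt T))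
                 ((b : ℝ) ^ (((d : ℝ) * ℓ - δ * q) / T)))
            (max ((b : ℝ) ^ ((ℓ : ℝ) / L₀)) ((W₀ : ℝ) * 2 ^ W₀)) ∧
        (L : ℝ) ≤ C * ((S : ℝ) * T + L₀) ∧
        ∃ g ∈ NN d 1 W L,
          eLpNorm (fun x => ppoly d b ℓ k a x - g x 0) p
              (volume.restrict (goodRegion d b ℓ ε)) ≤
            ENNReal.ofReal (C *
              ((b : ℝ) ^ (δ * q / p.toReal - (d : ℝ) * ℓ / p.toReal - δ) +
                (4 : ℝ) ^ (-((W₀ : ℝ) * L₀))) *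
              (∑ i : Fin d → Fin (b ^ ℓ), ∑ γ ∈ Γset d k, |a i γ| ^ q) ^ (1 / q)) := by

  have hb0 : 0 < b := by omega
  have hβ1 : (1 : ℝ) ≤ b := by exact_mod_cast hb0
  have hβ : (0 : ℝ) < b := by positivity
  have hp1 : 1 ≤ p := le_trans (by rw [← ENNReal.ofReal_one]; exact ENNReal.ofReal_le_ofReal hq) hqp
  have hq0 : 0 < q := by linarith
  set G := (Γset d k).card with hG
  have hC₁ : (0 : ℝ) ≤ 10 * d + G * (216 + 2 * d) + 1 := by positivity
  have hC₂ : (0 : ℝ) < 14 + 3 * k := by positivity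
  have hC₃ : (0 : ℝ) ≤ G * (1 + 2 * k) := by positivity
  refine ⟨(10 * d + G * (216 + 2 * d) + 1) + (14 + 3 * k) + G * (1 + 2 * k), by linarith, ?_⟩
  intro ℓ ε δ hε _ hδ hδq a S T W₀ L₀ hS hT hW₀ hL₀
  have hS0 : (0 : ℝ) < S := by exact_mod_cast hS
  have hT0 : (0 : ℝ) < T := by exact_mod_cast hT
  have hL0 : (0 : ℝ) < L₀ := by exact_mod_cast hL₀
  set U := (b : ℝ) ^ (δ * q / 2) / ((S : ℝ) * Real.sqrt T) with hU
  set R := (b : ℝ) ^ (((d : ℝ) * ℓ - δ * q) / T) with hR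
  set P := (b : ℝ) ^ ((ℓ : ℝ) / L₀) with hP
  set V := max (max U R) (max P ((W₀ : ℝ) * 2 ^ W₀)) with hV
  set A := (∑ i : Fin d → Fin (b ^ ℓ), ∑ γ ∈ Γset d k, |a i γ| ^ q) ^ (1 / q) with hA
  set Y := (4 : ℝ) ^ (-((W₀ : ℝ) * L₀)) with hY
  set E := δ * q / p.toReal - (d : ℝ) * ℓ / p.toReal - δ with hE
  have hU0 : 0 < U := by positivity
  have hR1 : 1 ≤ R := Real.one_le_rpow hβ1 (div_nonneg (by linarith) hT0.le)
  have hRT : R ^ T = (b : ℝ) ^ ((d : ℝ) * ℓ - δ * q) := by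
    rw [hR, ← Real.rpow_natCast, ← Real.rpow_mul hβ.le, div_mul_cancel₀ _ hT0.ne']
  have hPL : P ^ L₀ = (b : ℝ) ^ ℓ := by
    rw [hP, ← Real.rpow_natCast, ← Real.rpow_mul hβ.le, div_mul_cancel₀ _ hL0.ne',
      Real.rpow_natCast]
  have hP0 : 0 < P := by positivity
  have hZ1 : 1 ≤ (b : ℝ) ^ ((d : ℝ) * ℓ - δ * q) := Real.one_le_rpow hβ1 (by linarith)
  have hM1 : 1 ≤ (b : ℝ) ^ (δ * q) := Real.one_le_rpow hβ1 (by positivity)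
  have hBd : ((b : ℝ) ^ ℓ) ^ d = (b : ℝ) ^ ((d : ℝ) * ℓ) := by
    rw [← pow_mul, ← Real.rpow_natCast]
    push_cast
    rw [mul_comm]
  have hτ : 0 < (b : ℝ) ^ (-δ) := by positivity
  have hs0 : 0 ≤ ∑ i : Fin d → Fin (b ^ ℓ), ∑ γ ∈ Γset d k, |a i γ| ^ q :=
    Finset.sum_nonneg fun i _ => Finset.sum_nonneg fun γ _ => Real.rpow_nonneg (abs_nonneg _) _
  have hA0 : 0 ≤ A := Real.rpow_nonneg hs0 _
  have hAq : A ^ q = ∑ i : Fin d → Fin (b ^ ℓ), ∑ γ ∈ Γset d k, |a i γ| ^ q := by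
    rw [hA, ← Real.rpow_mul hs0, one_div, inv_mul_cancel₀ hq0.ne', Real.rpow_one]
  have haA : ∀ γ ∈ Γset d k, ∑ i, |a i γ| ^ q ≤ A ^ q := fun γ hγ => by
    rw [hAq]
    exact Finset.sum_le_sum fun i _ => Finset.single_le_sum (f := fun γ => |a i γ| ^ q)
      (fun γ _ => Real.rpow_nonneg (abs_nonneg _) _) hγ
  have haA1 : ∀ γ ∈ Γset d k, ∀ i, |a i γ| ≤ A := fun γ hγ i =>
    (Real.rpow_le_rpow_iff (abs_nonneg _) hA0 hq0).1
      ((Finset.single_le_sum (f := fun i => |a i γ| ^ q)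
        (fun i _ => Real.rpow_nonneg (abs_nonneg _) _) (Finset.mem_univ i)).trans (haA γ hγ))
  have hn : (2 : ℝ) / (((2 ^ W₀ : ℕ) : ℝ) ^ 2) ^ L₀ = 2 * Y := by
    rw [hY, Real.rpow_neg (by norm_num), ← Nat.cast_mul, Real.rpow_natCast, div_eq_mul_inv]
    push_cast
    rw [← pow_mul, ← pow_mul, mul_left_comm, pow_mul]
    norm_num
  obtain ⟨g, hg, hfg⟩ := exists_network (d := d) (b := b) (ℓ := ℓ) (ε := ε) (k := k)
    (M := ⌈(b : ℝ) ^ (δ * q)⌉₊) (S := S) (T := T) (K := ⌈(b : ℝ) ^ ((d : ℝ) * ℓ - δ * q)⌉₊)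
    (Q := 3 * ⌈R⌉₊) (w := ⌈2 * U⌉₊) (n := 2 ^ W₀) (Q₂ := ⌈P⌉₊) (L := L₀) (A := A)
    hb0 hε hq hτ hA0 hS hT (Nat.ceil_pos.2 (by positivity)) (Nat.ceil_pos.2 (by positivity))
    (by positivity)
    (by
      have h1 := Nat.ceil_lt_add_one (zero_le_one.trans hZ1)
      have h2 : R ^ T ≤ (⌈R⌉₊ : ℝ) ^ T := by gcongr; exact Nat.le_ceil R
      have h3 : (3 : ℝ) ≤ 3 ^ T := le_self_pow₀ (by norm_num) (by omega)
      have h4 : (3 : ℝ) * R ^ T ≤ 3 ^ T * (⌈R⌉₊ : ℝ) ^ T := by gcongr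
      rw [← Nat.cast_lt (α := ℝ)]
      push_cast
      rw [mul_pow]
      linarith)
    (by
      rw [← Real.rpow_mul hβ.le, neg_mul_neg]
      exact Nat.le_ceil _)
    (by
      rw [← Nat.cast_le (α := ℝ)]
      push_cast
      rw [hBd]
      calc (b : ℝ) ^ ((d : ℝ) * ℓ) = (b : ℝ) ^ ((d : ℝ) * ℓ - δ * q) * (b : ℝ) ^ (δ * q) := by
            rw [← Real.rpow_add hβ, sub_add_cancel]
        _ ≤ _ := mul_le_mul (Nat.le_ceil _) (Nat.le_ceil _) (by positivity) (by positivity))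
    (by
      have h1 := Nat.ceil_lt_add_one (zero_le_one.trans hM1)
      have h2 : (2 * U) ^ 2 ≤ (⌈2 * U⌉₊ : ℝ) ^ 2 := by gcongr; exact Nat.le_ceil _
      have h3 : (2 * U) ^ 2 * S ^ 2 * T = 4 * (b : ℝ) ^ (δ * q) := by
        have h4 : ((b : ℝ) ^ (δ * q / 2)) ^ 2 = (b : ℝ) ^ (δ * q) := by
          rw [← Real.rpow_natCast, ← Real.rpow_mul hβ.le]
          congr 1
          push_cast
          ring
        rw [hU, mul_pow, div_pow, mul_pow, Real.sq_sqrt hT0.le, h4]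
        field_simp
        norm_num
      have h5 : (2 * U) ^ 2 * S ^ 2 * T ≤ (⌈2 * U⌉₊ : ℝ) ^ 2 * S ^ 2 * T := by gcongr
      rw [← Nat.cast_le (α := ℝ)]
      push_cast
      linarith)
    (Nat.ceil_pos.2 (by positivity))
    (by
      rw [← Nat.cast_le (α := ℝ)]
      push_cast
      rw [← hPL]
      gcongr
      exact Nat.le_ceil P)
    a (fun i γ => a i γ / A)
    (fun γ hγ => by
      simp only [abs_div, abs_of_nonneg hA0, Real.div_rpow (abs_nonneg _) hA0]
      rw [← Finset.sum_div]
      exact div_le_one_of_le₀ (haA γ hγ) (Real.rpow_nonneg hA0 _))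
    (fun γ hγ i => by
      rcases hA0.eq_or_lt with h | h
      · have h1 := haA1 γ hγ i
        rw [← h] at h1 ⊢
        simpa using h1
      · rw [mul_div_cancel₀ _ h.ne'])
  rw [hn] at hfg
  have hY0 : 0 < Y := by positivity
  have hX0 : 0 < (b : ℝ) ^ E := by positivity
  refine ⟨_, _, ?_, ?_, ?_, ?_, g, hg, ?_⟩
  · omega
  · omega
  · have hWV : (W₀ : ℝ) * 2 ^ W₀ ≤ V := (le_max_right _ _).trans (le_max_right _ _)
    have hRV : R ≤ V := (le_max_right _ _).trans (le_max_left _ _)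
    have hUV : U ≤ V := (le_max_left _ _).trans (le_max_left _ _)
    have hPV : P ≤ V := (le_max_left _ _).trans (le_max_right _ _)
    have h1 := Nat.ceil_lt_add_one (a := 2 * U) (by positivity)
    have h2 := Nat.ceil_lt_add_one (a := R) (by positivity)
    have h3 := Nat.ceil_lt_add_one (a := P) (by positivity)
    have h4 : (1 : ℝ) ≤ W₀ := by exact_mod_cast hW₀
    refine (width_le (d := d) (G := G) (V := V) (hR1.trans hRV) (by linarith)
      (by push_cast; linarith) (by linarith) ?_).trans ?_
    · push_cast
      exact (le_mul_of_one_le_left (by positivity) h4).trans hWV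
    · exact mul_le_mul_of_nonneg_right (by linarith) (by linarith)
  · refine (Nat.cast_le.2 (depth_le (k := k) hS hT hL₀)).trans ?_
    push_cast
    exact mul_le_mul_of_nonneg_right (by linarith) (by positivity)
  · refine (eLpNorm_le_of_stepFun (k := k) hb0 hp1 (I := Γset d k)
      (e := fun γ i => min (A * (b : ℝ) ^ (-δ)) |a i γ|) (κ := A * (k * (2 * Y)))
      (D := A * (b : ℝ) ^ E) (fun γ i => le_min (by positivity) (abs_nonneg _)) (by positivity)
      (by positivity) (fun h γ _ i => ?_) (fun h γ hγ => ?_) hfg).trans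
      (ENNReal.ofReal_le_ofReal ?_)
    · rw [hE, h, ENNReal.toReal_top, _root_.div_zero, _root_.div_zero, sub_zero, zero_sub]
      exact min_le_left _ _
    · have hr := (ENNReal.ofReal_le_iff_le_toReal h).1 hqp
      have hr0 : p.toReal ≠ 0 := by linarith
      refine (sum_min_rpow_le hA0 hq0.le hr hτ.le (haA γ hγ)).trans (le_of_eq ?_)
      rw [Real.mul_rpow hA0 hX0.le, hBd, mul_left_comm, ← Real.rpow_mul hβ.le,
        ← Real.rpow_mul hβ.le, ← Real.rpow_add hβ]
      congr 2
      rw [hE]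
      field_simp
      ring
    · calc (G : ℝ) * (A * (b : ℝ) ^ E + A * (k * (2 * Y)))
          ≤ G * ((1 + 2 * k) * ((b : ℝ) ^ E + Y) * A) := by
            refine mul_le_mul_of_nonneg_left ?_ (Nat.cast_nonneg G)
            nlinarith [mul_nonneg hA0 (mul_nonneg (Nat.cast_nonneg (α := ℝ) k) hX0.le),
              mul_nonneg hA0 hY0.le]
        _ = G * (1 + 2 * k) * ((b : ℝ) ^ E + Y) * A := by ring
        _ ≤ _ := mul_le_mul_of_nonneg_right (mul_le_mul_of_nonneg_right
            (le_add_of_nonneg_left (add_nonneg hC₁ hC₂.le)) (by positivity)) hA0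
end
end
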